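/- Let Ω be an open subset of ℂ^{m−1}, let Y be a Nash subset of Ω × ℂ of pure dimension k with proper projection onto Ω, and let Γ ⊂⊂ Ω be a bounded open semi-algebraic subset of ℂ^{m−1} (for instance the interior of a compact polynomial polyhedron contained in Ω). Then Y ∩ (Γ × ℂ) has only finitely many analytic irreducible components. -/

import Mathlib

open Set Filter Topology MvPolynomial

noncomputable section

/-- The complex Euclidean space `ℂ^N`. -/
abbrev CE (N : ℕ) := Fin N → ℂ

/-- The natural projection `ℂ^{a+b} → ℂ^a` (onto the first `a` coordinates). -/
def projFst (a b : ℕ) (z : CE (a + b)) : CE a := fun i => z (Fin.castAdd b i)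

/-- The natural projection `ℂ^{a+b} → ℂ^b` (onto the last `b` coordinates). -/
def projSnd (a b : ℕ) (z : CE (a + b)) : CE b := fun i => z (Fin.natAdd a i)

/-- The cylinder `U × ℂ^b ⊆ ℂ^{a+b}` over `U ⊆ ℂ^a`. -/
def cylOver {a : ℕ} (b : ℕ) (U : Set (CE a)) : Set (CE (a + b)) :=
  {z | projFst a b z ∈ U}

/-- The product `U × B ⊆ ℂ^{a+b}` of `U ⊆ ℂ^a` and `B ⊆ ℂ^b`. -/
def prodSet {a b : ℕ} (U : Set (CE a)) (B : Set (CE b)) : Set (CE (a + b)) :=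
  {z | projFst a b z ∈ U ∧ projSnd a b z ∈ B}

/-- The open ball of radius `r` in `ℂ = ℂ^1`. -/
def ball1 (r : ℝ) : Set (CE 1) := {w | ‖w 0‖ < r}

/-- The open Euclidean ball of radius `t` in `ℂ^l`. -/
def eball (l : ℕ) (t : ℝ) : Set (CE l) := {x | ∑ i, ‖x i‖ ^ 2 < t ^ 2}

/-- An algebraic subset of `ℂ^N`: the common zero set of finitely many polynomials. -/
def IsAlgebraicSet {N : ℕ} (X : Set (CE N)) : Prop :=
  ∃ s : Finset (MvPolynomial (Fin N) ℂ), X = {z | ∀ p ∈ s, eval z p = 0}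

/-- An analytic subset `X` of an open set `Ω ⊆ ℂ^N`: locally (at every point of `Ω`)
the common zero set of finitely many holomorphic functions. -/
def IsAnalyticSet {N : ℕ} (Ω X : Set (CE N)) : Prop :=
  X ⊆ Ω ∧ ∀ z ∈ Ω, ∃ U : Set (CE N), IsOpen U ∧ z ∈ U ∧ U ⊆ Ω ∧
    ∃ s : Finset (CE N → ℂ), (∀ f ∈ s, AnalyticOnNhd ℂ f U) ∧
      X ∩ U = {w ∈ U | ∀ f ∈ s, f w = 0}

/-- `X` is, near `a`, a `d`-dimensional complex submanifold of `ℂ^N`: there is a local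
biholomorphism straightening `X` to the linear subspace `{z : z_i = 0 for i ≥ d}`. -/
def IsSubmanifoldPtOfDim {N : ℕ} (X : Set (CE N)) (d : ℕ) (a : CE N) : Prop :=
  ∃ (V W : Set (CE N)) (φ ψ : CE N → CE N),
    IsOpen V ∧ a ∈ V ∧ IsOpen W ∧
    AnalyticOnNhd ℂ φ V ∧ AnalyticOnNhd ℂ ψ W ∧
    MapsTo φ V W ∧ MapsTo ψ W V ∧
    (∀ x ∈ V, ψ (φ x) = x) ∧ (∀ y ∈ W, φ (ψ y) = y) ∧
    φ '' (X ∩ V) = W ∩ {z | ∀ i : Fin N, d ≤ (i : ℕ) → z i = 0}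

/-- `X` is purely `k`-dimensional: every point of `X` near which `X` is a submanifold is a
point of dimension exactly `k`, and such (regular) points are dense in `X`. -/
def PureDimOf {N : ℕ} (X : Set (CE N)) (k : ℕ) : Prop :=
  (∀ a ∈ X, a ∈ closure {b | b ∈ X ∧ IsSubmanifoldPtOfDim X k b}) ∧
  (∀ b ∈ X, ∀ d, IsSubmanifoldPtOfDim X d b → d = k)

/-- The singular locus of `X`: the points of `X` at which `X` is not locally a submanifold. -/
def singLocus {N : ℕ} (X : Set (CE N)) : Set (CE N) :=
  {a ∈ X | ¬ ∃ d, IsSubmanifoldPtOfDim X d a}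

/-- An irreducible analytic subset of the open set `Ω`. -/
def IsIrreducibleAnalyticSet {N : ℕ} (Ω X : Set (CE N)) : Prop :=
  IsAnalyticSet Ω X ∧ X.Nonempty ∧
  ∀ A B : Set (CE N), IsAnalyticSet Ω A → IsAnalyticSet Ω B → X = A ∪ B → X = A ∨ X = B

/-- `C` is an (analytic) irreducible component of the analytic set `X ⊆ Ω`:
an irreducible analytic subset of `Ω` contained in `X`, maximal among such. -/
def IsIrreducibleComponent {N : ℕ} (Ω X C : Set (CE N)) : Prop :=
  IsIrreducibleAnalyticSet Ω C ∧ C ⊆ X ∧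
  ∀ C' : Set (CE N), IsIrreducibleAnalyticSet Ω C' → C ⊆ C' → C' ⊆ X → C' = C

/-- `A` is the union of some of the analytic irreducible components of `X` in `Ω`. -/
def IsUnionOfComponents {N : ℕ} (Ω X A : Set (CE N)) : Prop :=
  ∃ 𝒞 : Set (Set (CE N)), (∀ C ∈ 𝒞, IsIrreducibleComponent Ω X C) ∧ A = ⋃₀ 𝒞

/-- The germ of the analytic set `Z` at `a` is irreducible. -/
def GermIrreducibleAt {N : ℕ} (Z : Set (CE N)) (a : CE N) : Prop :=
  ∀ U A B : Set (CE N), IsOpen U → a ∈ U → IsAnalyticSet U A → IsAnalyticSet U B →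
    Z ∩ U = A ∪ B →
    (∃ V, IsOpen V ∧ a ∈ V ∧ Z ∩ V = A ∩ V) ∨ (∃ V, IsOpen V ∧ a ∈ V ∧ Z ∩ V = B ∩ V)

/-- A Nash function on the open set `U ⊆ ℂ^N`: a holomorphic function annihilated,
locally around every point of `U`, by a nonzero polynomial `P(x, f(x)) = 0`. -/
def IsNashFn {N : ℕ} (U : Set (CE N)) (f : CE N → ℂ) : Prop :=
  AnalyticOnNhd ℂ f U ∧ ∀ x₀ ∈ U, ∃ V : Set (CE N), IsOpen V ∧ x₀ ∈ V ∧ V ⊆ U ∧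
    ∃ P : MvPolynomial (Fin (N + 1)) ℂ, P ≠ 0 ∧
      ∀ x ∈ V, eval (Fin.snoc x (f x)) P = 0

/-- A Nash subset `Y` of the open set `Ω ⊆ ℂ^N`: locally (at every point of `Ω`) the common
zero set of finitely many Nash functions. -/
def IsNashSet {N : ℕ} (Ω Y : Set (CE N)) : Prop :=
  Y ⊆ Ω ∧ ∀ y ∈ Ω, ∃ U : Set (CE N), IsOpen U ∧ y ∈ U ∧ U ⊆ Ω ∧
    ∃ s : Finset (CE N → ℂ), (∀ f ∈ s, IsNashFn U f) ∧
      Y ∩ U = {x ∈ U | ∀ f ∈ s, f x = 0}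

/-- `U` is a domain of holomorphy in `ℂ^N`. -/
def IsDomainOfHolomorphy {N : ℕ} (U : Set (CE N)) : Prop :=
  IsOpen U ∧ ¬ ∃ U₁ U₂ : Set (CE N), IsOpen U₁ ∧ IsOpen U₂ ∧ U₁.Nonempty ∧
    U₁ ⊆ U ∩ U₂ ∧ IsConnected U₂ ∧ ¬ U₂ ⊆ U ∧
    ∀ f : CE N → ℂ, AnalyticOnNhd ℂ f U →
      ∃ F : CE N → ℂ, AnalyticOnNhd ℂ F U₂ ∧ EqOn f F U₁

/-- A Runge domain in `ℂ^N`: a domain of holomorphy on which every holomorphic function can be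
approximated uniformly on compact subsets by polynomials. -/
def IsRungeDomain {N : ℕ} (U : Set (CE N)) : Prop :=
  IsDomainOfHolomorphy U ∧
  ∀ f : CE N → ℂ, AnalyticOnNhd ℂ f U → ∀ K : Set (CE N), IsCompact K → K ⊆ U →
    ∀ ε : ℝ, 0 < ε → ∃ p : MvPolynomial (Fin N) ℂ, ∀ z ∈ K, ‖f z - eval z p‖ < ε

/-- The projection `ℂ^{a+b} → ℂ^a` restricted to `X` maps `X` into `U` and is proper over `U`. -/
def ProperProjTo {a b : ℕ} (X : Set (CE (a + b))) (U : Set (CE a)) : Prop :=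
  (∀ z ∈ X, projFst a b z ∈ U) ∧
  ∀ K : Set (CE a), IsCompact K → K ⊆ U → IsCompact {z ∈ X | projFst a b z ∈ K}

/-- Local uniform convergence of the closed subsets `Y ν` of `W` to `Y'`. -/
def LocUnifConvSets {N : ℕ} (W : Set (CE N)) (Y : ℕ → Set (CE N)) (Y' : Set (CE N)) : Prop :=
  (∀ a ∈ Y', ∃ u : ℕ → CE N, (∀ ν, u ν ∈ Y ν) ∧ Tendsto u atTop (𝓝 a)) ∧
  ∀ K : Set (CE N), IsCompact K → K ⊆ W → K ∩ Y' = ∅ → ∀ᶠ ν in atTop, K ∩ Y ν = ∅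

/-- `X` and `T` meet transversally at `a`: their tangent spaces at `a` span `ℂ^N`. -/
def TransversalAt {N : ℕ} (X T : Set (CE N)) (a : CE N) : Prop :=
  Submodule.span ℂ (tangentConeAt ℂ X a ∪ tangentConeAt ℂ T a) = ⊤

/-- `T` is a `d`-dimensional complex submanifold of the open set `W`. -/
def IsSubmanifoldOfDim {N : ℕ} (W T : Set (CE N)) (d : ℕ) : Prop :=
  T ⊆ W ∧ ∀ a ∈ T, IsSubmanifoldPtOfDim T d a

/-- Convergence, in the open set `W ⊆ ℂ^N`, of the purely `k`-dimensional analytic sets `Z ν`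
to the purely `k`-dimensional analytic set `Z'` in the sense of holomorphic chains (all
multiplicities being `1`): local uniform convergence of supports, together with the degree
condition: for every regular point `a` of `Z'` and every `(N-k)`-dimensional submanifold `T`
transversal to `Z'` at `a`, with compact closure contained in `W` and meeting `Z'` only at `a`
(so that `deg(Z' · T) = 1`), for almost all `ν` the chain `Z ν · T` also has degree one, i.e.
`Z ν` meets `T` in exactly one point, which is a regular point of `Z ν` where the intersection
is transversal. -/
def ChainsConvTo {N : ℕ} (W : Set (CE N)) (k : ℕ) (Z : ℕ → Set (CE N))
    (Z' : Set (CE N)) : Prop :=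
  LocUnifConvSets W Z Z' ∧
  ∀ (a : CE N) (T : Set (CE N)), a ∈ Z' → IsSubmanifoldPtOfDim Z' k a →
    IsSubmanifoldOfDim W T (N - k) → IsCompact (closure T) → closure T ⊆ W →
    Z' ∩ closure T = {a} → TransversalAt Z' T a →
    ∀ᶠ ν in atTop, ∃ b, Z ν ∩ T = {b} ∧ IsSubmanifoldPtOfDim (Z ν) k b ∧
      TransversalAt (Z ν) T b

/-- A polynomial polyhedron in `ℂ^N`: a set of the form `{z : |q₁ z| ≤ c₁, …, |q_s z| ≤ c_s}`. -/
def IsPolyPolyhedron {N : ℕ} (P : Set (CE N)) : Prop :=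
  ∃ (s : Finset (MvPolynomial (Fin N) ℂ)) (c : MvPolynomial (Fin N) ℂ → ℝ),
    P = {z | ∀ q ∈ s, ‖eval z q‖ ≤ c q}

/-- A compact set `K ⊆ ℂ^N` is polynomially convex: it equals its polynomially convex hull. -/
def PolyConvex {N : ℕ} (K : Set (CE N)) : Prop :=
  K = {z | ∀ p : MvPolynomial (Fin N) ℂ,
    ‖eval z p‖ ≤ sSup ((fun w => ‖eval w p‖) '' K)}

/-- Sign condition used in the definition of semialgebraic sets. -/
def signCond (c : Ordering) (t : ℝ) : Prop :=
  match c with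
  | .lt => t < 0
  | .eq => t = 0
  | .gt => 0 < t

/-- Evaluation of a real polynomial in the `2m` real coordinates of `z ∈ ℂ^m`. -/
def realizeRe {m : ℕ} (p : MvPolynomial (Fin m ⊕ Fin m) ℝ) (z : CE m) : ℝ :=
  MvPolynomial.eval (Sum.elim (fun i => (z i).re) (fun i => (z i).im)) p

/-- A subset of `ℂ^m ≅ ℝ^{2m}` is semialgebraic: a finite union of finite intersections of
sets defined by polynomial sign conditions in the real coordinates. -/
def IsSemialgebraic {m : ℕ} (S : Set (CE m)) : Prop :=
  ∃ (n r : ℕ) (P : Fin n → Fin r → MvPolynomial (Fin m ⊕ Fin m) ℝ)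
    (σ : Fin n → Fin r → Ordering),
    S = ⋃ i, ⋂ j, {z | signCond (σ i j) (realizeRe (P i j) z)}

end
section PartA1
/-- A set that is a finite union of preconnected sets. -/
def FinConn {α : Type*} [TopologicalSpace α] (S : Set α) : Prop :=
  ∃ T : Set (Set α), T.Finite ∧ (∀ t ∈ T, IsPreconnected t) ∧ ⋃₀ T = S

section FinConnLemmas
variable {α β : Type*} [TopologicalSpace α] [TopologicalSpace β]

theorem finConn_of_preconn {S : Set α} (h : IsPreconnected S) : FinConn S :=
  ⟨{S}, finite_singleton _, by simpa using h, by simp⟩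

theorem FinConn.union {S S' : Set α} (h : FinConn S) (h' : FinConn S') : FinConn (S ∪ S') := by
  obtain ⟨T, hT, hc, rfl⟩ := h
  obtain ⟨T', hT', hc', rfl⟩ := h'
  exact ⟨T ∪ T', hT.union hT', fun t ht => ht.elim (hc t) (hc' t), by rw [sUnion_union]⟩

theorem FinConn.iUnion {ι : Type*} [Finite ι] {S : ι → Set α} (h : ∀ i, FinConn (S i)) :
    FinConn (⋃ i, S i) := by
  choose T hT hc hu using h
  refine ⟨⋃ i, T i, finite_iUnion hT, ?_, ?_⟩
  · intro t ht
    obtain ⟨i, hi⟩ := mem_iUnion.1 ht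
    exact hc i t hi
  · rw [sUnion_iUnion]
    exact iUnion_congr hu

theorem FinConn.image {S : Set α} (h : FinConn S) {f : α → β} (hf : Continuous f) :
    FinConn (f '' S) := by
  obtain ⟨T, hT, hc, rfl⟩ := h
  refine ⟨(fun t => f '' t) '' T, hT.image _, ?_, ?_⟩
  · rintro _ ⟨t, ht, rfl⟩
    exact (hc t ht).image f hf.continuousOn
  · rw [sUnion_image, sUnion_eq_biUnion, image_iUnion₂]

theorem finConn_of_meets {V V' : Set α} (hsub : V' ⊆ V) (h : FinConn V')
    (hm : ∀ x ∈ V, (connectedComponentIn V x ∩ V').Nonempty) : FinConn V := by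
  classical
  obtain ⟨T, hT, hc, rfl⟩ := h
  refine ⟨(fun t => if h : t.Nonempty then connectedComponentIn V h.some else ∅) '' T,
    hT.image _, ?_, ?_⟩
  · rintro _ ⟨t, ht, rfl⟩
    dsimp only
    split_ifs with h
    · exact isPreconnected_connectedComponentIn
    · exact isPreconnected_empty
  · apply Subset.antisymm
    · apply sUnion_subset
      rintro _ ⟨t, ht, rfl⟩
      dsimp only
      split_ifs with h
      · exact connectedComponentIn_subset _ _
      · exact empty_subset _
    · intro x hx
      obtain ⟨y, hy, t, ht, hyt⟩ := hm x hx
      refine ⟨_, ⟨t, ht, rfl⟩, ?_⟩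
      have hne : t.Nonempty := ⟨y, hyt⟩
      simp only [hne, dif_pos]
      have h1 : t ⊆ connectedComponentIn V hne.some :=
        (hc t ht).subset_connectedComponentIn hne.some_mem
          ((subset_sUnion_of_mem ht).trans hsub)
      rw [connectedComponentIn_eq (h1 hyt), ← connectedComponentIn_eq hy]
      exact mem_connectedComponentIn hx

theorem FinConn.finite_components {V : Set α} (h : FinConn V) :
    {C | ∃ x ∈ V, C = connectedComponentIn V x}.Finite := by
  classical
  obtain ⟨T, hT, hc, rfl⟩ := h
  refine (hT.image (fun t => if h : t.Nonempty then connectedComponentIn (⋃₀ T) h.some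
    else ∅)).subset ?_
  rintro _ ⟨x, ⟨t, ht, hxt⟩, rfl⟩
  refine ⟨t, ht, ?_⟩
  have hne : t.Nonempty := ⟨x, hxt⟩
  simp only [hne, dif_pos]
  have h1 : t ⊆ connectedComponentIn (⋃₀ T) hne.some :=
    (hc t ht).subset_connectedComponentIn hne.some_mem (subset_sUnion_of_mem ht)
  rw [connectedComponentIn_eq (h1 hxt)]

end FinConnLemmas

theorem hasDerivAt_eval_curve {σ : Type*} [Fintype σ] (p : MvPolynomial σ ℝ) {γ : ℝ → σ → ℝ}
    {w : σ → ℝ} {t : ℝ} (h : HasDerivAt γ w t) :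
    HasDerivAt (fun s => eval (γ s) p) (∑ j, w j * eval (γ t) (pderiv j p)) t := by
  classical
  induction p using MvPolynomial.induction_on with
  | C a => simpa using hasDerivAt_const t a
  | add p q hp hq =>
    have := hp.add hq
    simp only [map_add, mul_add, Finset.sum_add_distrib]
    exact this
  | mul_X p i hp =>
    have h2 := hp.mul (hasDerivAt_pi.1 h i)
    have e : ∑ j, w j * eval (γ t) (pderiv j (p * X i)) =
        (∑ j, w j * eval (γ t) (pderiv j p)) * γ t i + eval (γ t) p * w i := by
      simp only [Derivation.leibniz, pderiv_X, smul_eq_mul, map_add, map_mul, eval_X, mul_add,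
        Finset.sum_add_distrib, Finset.sum_mul]
      rw [add_comm]
      congr 1
      · exact Finset.sum_congr rfl fun j _ => by ring
      · rw [Finset.sum_eq_single i]
        · simp; ring
        · intro j _ hj
          simp [Pi.single_apply, hj.symm]
        · simp
    rw [e]
    simp only [map_mul, eval_X]
    exact h2

theorem contDiff_eval_mv {σ : Type*} [Fintype σ] (p : MvPolynomial σ ℝ) (n : WithTop ℕ∞) :
    ContDiff ℝ n (fun x : σ → ℝ => eval x p) := by
  induction p using MvPolynomial.induction_on with
  | C a => simpa using contDiff_const
  | add p q hp hq => simpa using hp.add hq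
  | mul_X p i hp => simpa using hp.mul (contDiff_apply ℝ ℝ i)
end PartA1

section PartA2
theorem curve_stays {σ : Type*} [Fintype σ] (I : Ideal (MvPolynomial σ ℝ))
    (W : σ → MvPolynomial σ ℝ) (hW : ∀ g ∈ I, ∑ j, W j * pderiv j g ∈ I)
    {γ : ℝ → σ → ℝ} {ε : ℝ}
    (hγ : ∀ t ∈ Ioo (-ε) ε, HasDerivAt γ (fun j => eval (γ t) (W j)) t)
    (h0 : ∀ p ∈ I, eval (γ 0) p = 0) :
    ∀ t ∈ Ico 0 ε, ∀ p ∈ I, eval (γ t) p = 0 := by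
  classical
  intro b hb
  obtain ⟨s, hs⟩ := (isNoetherianRing_iff_ideal_fg _).1 inferInstance I
  have hsI : ∀ g : s, (g : MvPolynomial σ ℝ) ∈ I := fun g => hs ▸ Ideal.subset_span g.2
  have hc : ∀ g : s, ∃ c : MvPolynomial σ ℝ → MvPolynomial σ ℝ,
      ∑ j, W j * pderiv j (g : MvPolynomial σ ℝ) = ∑ a ∈ s, c a * a := by
    intro g
    have h1 := hW g (hsI g)
    rw [← hs] at h1
    obtain ⟨f, -, hf⟩ := Submodule.mem_span_finset.1 h1
    exact ⟨f, by rw [← hf]; rfl⟩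
  choose c hc using hc
  have hsub : Icc 0 b ⊆ Ioo (-ε) ε := fun t ht =>
    ⟨by linarith [ht.1, hb.1, hb.2], by linarith [ht.2, hb.2]⟩
  have hγc : ContinuousOn γ (Icc 0 b) := fun t ht =>
    (hγ t (hsub ht)).continuousAt.continuousWithinAt
  have hcont : ∀ p : MvPolynomial σ ℝ, ContinuousOn (fun t => eval (γ t) p) (Icc 0 b) := fun p =>
    (MvPolynomial.continuous_eval p).comp_continuousOn hγc
  let κ : ℝ → ℝ := fun t => ∑ g : s, ∑ a : s, |eval (γ t) (c g a)|
  have hκ : ContinuousOn κ (Icc 0 b) :=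
    continuousOn_finsetSum _ fun g _ => continuousOn_finsetSum _ fun a _ => (hcont _).abs
  obtain ⟨K, hK⟩ := isCompact_Icc.exists_bound_of_continuousOn hκ
  let G : ℝ → s → ℝ := fun t g => eval (γ t) (g : MvPolynomial σ ℝ)
  have hder : ∀ t ∈ Icc 0 b, HasDerivAt G
      (fun g => ∑ a : s, eval (γ t) (c g a) * G t a) t := by
    intro t ht
    rw [hasDerivAt_pi]
    intro g
    have h1 := hasDerivAt_eval_curve (g : MvPolynomial σ ℝ) (hγ t (hsub ht))
    have e : ∑ j, eval (γ t) (W j) * eval (γ t) (pderiv j (g : MvPolynomial σ ℝ)) =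
        ∑ a : s, eval (γ t) (c g a) * G t a := by
      have h2 := congrArg (eval (γ t)) (hc g)
      simp only [map_sum, map_mul] at h2
      rw [h2, ← Finset.sum_coe_sort s]
    rw [← e]
    exact h1
  have hz := eq_zero_of_abs_deriv_le_mul_abs_self_of_eq_zero_right (f := G)
    (f' := fun t g => ∑ a : s, eval (γ t) (c g a) * G t a) (K := K) (a := 0) (b := b)
    (fun t ht => (hder t ht).continuousAt.continuousWithinAt)
    (fun t ht => (hder t (Ico_subset_Icc_self ht)).hasDerivWithinAt)
    (by ext g; exact h0 _ (hsI g))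
    (by
      intro t ht
      have hk : κ t ≤ K := (le_abs_self _).trans (hK t (Ico_subset_Icc_self ht))
      have hk0 : 0 ≤ κ t := Finset.sum_nonneg fun _ _ => Finset.sum_nonneg fun _ _ => abs_nonneg _
      refine (pi_norm_le_iff_of_nonneg (mul_nonneg (hk0.trans hk) (norm_nonneg _))).2 fun g => ?_
      calc ‖∑ a : s, eval (γ t) (c g a) * G t a‖
          ≤ ∑ a : s, |eval (γ t) (c g a)| * ‖G t‖ := by
            refine (norm_sum_le _ _).trans (Finset.sum_le_sum fun a _ => ?_)
            rw [norm_mul]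
            exact mul_le_mul_of_nonneg_left (norm_le_pi_norm (G t) a) (norm_nonneg _)
        _ = (∑ a : s, |eval (γ t) (c g a)|) * ‖G t‖ := by rw [Finset.sum_mul]
        _ ≤ κ t * ‖G t‖ := by
            refine mul_le_mul_of_nonneg_right ?_ (norm_nonneg _)
            exact Finset.single_le_sum (f := fun g : s => ∑ a : s, |eval (γ t) (c g a)|)
              (fun _ _ => Finset.sum_nonneg fun _ _ => abs_nonneg _) (Finset.mem_univ g)
        _ ≤ K * ‖G t‖ := mul_le_mul_of_nonneg_right hk (norm_nonneg _))
    b (right_mem_Icc.2 hb.1)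
  intro p hp
  rw [← hs] at hp
  obtain ⟨f, -, hf⟩ := Submodule.mem_span_finset.1 hp
  rw [← hf, map_sum]
  refine Finset.sum_eq_zero fun a ha => ?_
  have : G b ⟨a, ha⟩ = 0 := congrFun hz _
  rw [smul_eq_mul, map_mul]
  exact mul_eq_zero_of_right _ this

/-- One-sided first order condition at a nearest point. -/
theorem nearest_deriv_nonneg {σ : Type*} [Fintype σ] (I : Ideal (MvPolynomial σ ℝ))
    (W : σ → MvPolynomial σ ℝ) (hW : ∀ g ∈ I, ∑ j, W j * pderiv j g ∈ I)
    (a x : σ → ℝ) (hx : ∀ p ∈ I, eval x p = 0)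
    (hmin : ∀ y ∈ connectedComponentIn {x : σ → ℝ | ∀ p ∈ I, eval x p = 0} x,
      ∑ i, (x i - a i) ^ 2 ≤ ∑ i, (y i - a i) ^ 2) :
    0 ≤ ∑ i, (x i - a i) * eval x (W i) := by
  have hsm : ContDiff ℝ 1 (fun y : σ → ℝ => fun j => eval y (W j)) :=
    contDiff_pi.2 fun j => contDiff_eval_mv _ _
  obtain ⟨γ, hγ0, ε, hε, hγ⟩ :=
    (hsm.contDiffAt (x := x)).exists_forall_mem_closedBall_exists_eq_forall_mem_Ioo_hasDerivAt₀ 0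
  simp only [zero_sub, zero_add] at hγ
  have hstay := curve_stays I W hW hγ (by rw [hγ0]; exact hx)
  have hcomp : ∀ t ∈ Ico 0 ε,
      γ t ∈ connectedComponentIn {x : σ → ℝ | ∀ p ∈ I, eval x p = 0} x := by
    have hpre : IsPreconnected (γ '' Ico 0 ε) := isPreconnected_Ico.image _ fun t ht =>
      (hγ t ⟨by linarith [ht.1], ht.2⟩).continuousAt.continuousWithinAt
    have hsub := hpre.subset_connectedComponentIn (x := x)
      (F := {x : σ → ℝ | ∀ p ∈ I, eval x p = 0})
      ⟨0, ⟨le_rfl, hε⟩, hγ0⟩ (by rintro _ ⟨t, ht, rfl⟩; exact hstay t ht)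
    exact fun t ht => hsub ⟨t, ht, rfl⟩
  have hd : HasDerivAt (fun t => ∑ i, (γ t i - a i) ^ 2)
      (∑ i, 2 * (x i - a i) * eval x (W i)) 0 := by
    have h1 := hasDerivAt_pi.1 (hγ 0 ⟨by linarith, hε⟩)
    refine HasDerivAt.fun_sum fun i _ => ?_
    have := ((h1 i).sub_const (a i)).pow 2
    rw [hγ0] at this
    simp at this
    exact this
  by_contra hneg
  push Not at hneg
  have hneg2 : ∑ i, 2 * (x i - a i) * eval x (W i) < 0 := by
    have : ∑ i, 2 * (x i - a i) * eval x (W i) = 2 * ∑ i, (x i - a i) * eval x (W i) := by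
      rw [Finset.mul_sum]; exact Finset.sum_congr rfl fun i _ => by ring
    linarith
  have hslope := (hasDerivWithinAt_iff_tendsto_slope' (s := Ioi (0 : ℝ))
    (by simp)).1 hd.hasDerivWithinAt
  have hev := hslope.eventually (gt_mem_nhds hneg2)
  have hev2 : ∀ᶠ t in 𝓝[>] (0 : ℝ), t ∈ Ioo 0 ε := Ioo_mem_nhdsGT hε
  obtain ⟨t, ht1, ht2⟩ := (hev.and hev2).exists
  rw [slope_def_field, hγ0, div_lt_iff₀ (by linarith [ht2.1])] at ht1
  have := hmin _ (hcomp t ⟨ht2.1.le, ht2.2⟩)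
  linarith

theorem exists_nearest {σ : Type*} [Fintype σ] (K : Set (σ → ℝ)) (hK : IsClosed K)
    (hne : K.Nonempty) (a : σ → ℝ) :
    ∃ x ∈ K, ∀ y ∈ K, ∑ i, (x i - a i) ^ 2 ≤ ∑ i, (y i - a i) ^ 2 := by
  let e : EuclideanSpace ℝ σ ≃ₜ (σ → ℝ) := (PiLp.homeomorph 2 (fun _ : σ => ℝ))
  have hK' : IsClosed (e ⁻¹' K) := hK.preimage e.continuous
  obtain ⟨y0, hy0⟩ := hne
  obtain ⟨x, hx, hxd⟩ := hK'.exists_infDist_eq_dist ⟨e.symm y0, by simpa using hy0⟩ (e.symm a)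
  refine ⟨e x, hx, fun y hy => ?_⟩
  have h1 : dist (e.symm a) x ≤ dist (e.symm a) (e.symm y) := by
    rw [← hxd]
    exact Metric.infDist_le_dist_of_mem (by simpa using hy)
  rw [EuclideanSpace.dist_eq, EuclideanSpace.dist_eq] at h1
  have h2 := (Real.sqrt_le_sqrt_iff (by positivity)).1 h1
  convert h2 using 2 with i _ i _
  · rw [Real.dist_eq, sq_abs]
    change (x.ofLp i - a i) ^ 2 = (a i - x.ofLp i) ^ 2
    ring
  · rw [Real.dist_eq, sq_abs]
    change (y i - a i) ^ 2 = (a i - y i) ^ 2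
    ring
end PartA2

section PartA3
/-- First order Taylor expansion at a point. -/
theorem taylor_one {σ : Type*} [Fintype σ] (x : σ → ℝ) (g : MvPolynomial σ ℝ) :
    g - C (eval x g) - ∑ j, C (eval x (pderiv j g)) * (X j - C (x j)) ∈
      (RingHom.ker (eval x : MvPolynomial σ ℝ →+* ℝ)) ^ 2 := by
  classical
  set m := RingHom.ker (eval x : MvPolynomial σ ℝ →+* ℝ) with hm
  have hX : ∀ j, X j - C (x j) ∈ m := fun j => by simp [hm, RingHom.mem_ker]
  induction g using MvPolynomial.induction_on with
  | C a => simp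
  | add p q hp hq =>
    have := add_mem hp hq
    convert this using 1
    simp only [map_add, add_mul, Finset.sum_add_distrib]
    ring
  | mul_X p i hp =>
    have h1 : (p - C (eval x p)) * (X i - C (x i)) ∈ m ^ 2 := by
      rw [pow_two]
      exact Ideal.mul_mem_mul (by simp [hm, RingHom.mem_ker]) (hX i)
    have h2 := add_mem (Ideal.mul_mem_left _ (C (x i)) hp) h1
    convert h2 using 1
    have e : ∑ j, C (eval x (pderiv j (p * X i))) * (X j - C (x j)) =
        C (x i) * ∑ j, C (eval x (pderiv j p)) * (X j - C (x j)) +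
          C (eval x p) * (X i - C (x i)) := by
      simp only [Derivation.leibniz, pderiv_X, smul_eq_mul, map_add, map_mul, eval_X, add_mul,
        Finset.sum_add_distrib, Finset.mul_sum]
      rw [add_comm]
      congr 1
      · exact Finset.sum_congr rfl fun j _ => by ring
      · rw [Finset.sum_eq_single i]
        · simp
        · intro j _ hj
          simp [hj.symm]
        · simp
    rw [e]
    simp only [map_mul, eval_X]
    ring

/-- Either the gradients of the elements of a prime ideal span everything generically, or there is
a nontrivial polynomial vector field tangent to the ideal. -/
theorem gradient_dichotomy {σ : Type*} [Fintype σ] [DecidableEq σ] (I : Ideal (MvPolynomial σ ℝ)) [hI : I.IsPrime] :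
    (∀ j, ∃ q, q ∉ I ∧ ∃ G ∈ I, ∀ i, pderiv i G - (if i = j then q else 0) ∈ I) ∨
    (∃ W : σ → MvPolynomial σ ℝ, (∃ j, W j ∉ I) ∧ ∀ g ∈ I, ∑ j, W j * pderiv j g ∈ I) := by
  classical
  let A := MvPolynomial σ ℝ ⧸ I
  let K := FractionRing A
  let φ : MvPolynomial σ ℝ →+* K := (algebraMap A K).comp (Ideal.Quotient.mk I)
  have hφ : ∀ p, φ p = 0 ↔ p ∈ I := by
    intro p
    change algebraMap A K (Ideal.Quotient.mk I p) = 0 ↔ _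
    rw [FaithfulSMul.algebraMap_eq_zero_iff, Ideal.Quotient.eq_zero_iff_mem]
  have hφs : ∀ c : K, ∃ a b, φ b ≠ 0 ∧ c * φ b = φ a := by
    intro c
    obtain ⟨a, b, hb, rfl⟩ := IsFractionRing.div_surjective (A := A) c
    obtain ⟨a, rfl⟩ := Ideal.Quotient.mk_surjective a
    obtain ⟨b, rfl⟩ := Ideal.Quotient.mk_surjective b
    have hb0 : φ b ≠ 0 := by
      change algebraMap A K _ ≠ 0
      exact IsFractionRing.to_map_ne_zero_of_mem_nonZeroDivisors hb
    exact ⟨a, b, hb0, div_mul_cancel₀ _ hb0⟩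
  let N : Submodule K (σ → K) :=
    { carrier := {v | ∃ q, φ q ≠ 0 ∧ ∃ G ∈ I, ∀ i, φ (pderiv i G) = φ q * v i}
      zero_mem' := ⟨1, by simp, 0, I.zero_mem, by simp⟩
      add_mem' := by
        rintro v w ⟨q, hq, G, hG, h⟩ ⟨q', hq', G', hG', h'⟩
        refine ⟨q * q', by simp [hq, hq'], q' * G + q * G',
          I.add_mem (I.mul_mem_left _ hG) (I.mul_mem_left _ hG'), fun i => ?_⟩
        have e1 := (hφ _).2 hG
        have e2 := (hφ _).2 hG'
        simp only [map_add, Derivation.leibniz, smul_eq_mul, map_mul, h, h', e1, e2, Pi.add_apply]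
        ring
      smul_mem' := by
        rintro c v ⟨q, hq, G, hG, h⟩
        obtain ⟨a, b, hb, hc⟩ := hφs c
        refine ⟨q * b, by simp [hq, hb], a * G, I.mul_mem_left _ hG, fun i => ?_⟩
        have e1 := (hφ _).2 hG
        simp only [Derivation.leibniz, smul_eq_mul, map_mul, map_add, h, e1, Pi.smul_apply, ← hc]
        ring }
  by_cases hN : N = ⊤
  · left
    intro j
    have hj : (Pi.single j 1 : σ → K) ∈ N := hN ▸ Submodule.mem_top
    obtain ⟨q, hq, G, hG, h⟩ := hj
    refine ⟨q, fun h => hq ((hφ _).2 h), G, hG, fun i => ?_⟩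
    rw [← hφ, map_sub, h]
    by_cases hij : i = j
    · subst hij; simp
    · simp [hij]
  · right
    obtain ⟨f, hf0, hf⟩ := Submodule.exists_le_ker_of_lt_top N (lt_top_iff_ne_top.2 hN)
    have hfs : ∀ v, f v = ∑ j, v j * f (Pi.single j 1) := by
      intro v
      conv_lhs => rw [← Finset.univ_sum_single v]
      rw [map_sum]
      refine Finset.sum_congr rfl fun j _ => ?_
      rw [← smul_eq_mul, ← map_smul, ← Pi.single_smul]
      simp
    obtain ⟨b, hb⟩ := IsLocalization.exist_integer_multiples_of_finite (nonZeroDivisors A)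
      (fun j => f (Pi.single j 1))
    have hb0 : algebraMap A K (b : A) ≠ 0 :=
      IsFractionRing.to_map_ne_zero_of_mem_nonZeroDivisors b.2
    choose w hw using hb
    choose W hWw using fun j => Ideal.Quotient.mk_surjective (I := I) (w j)
    have hW : ∀ j, φ (W j) = algebraMap A K (b : A) * f (Pi.single j 1) := by
      intro j
      change algebraMap A K (Ideal.Quotient.mk I (W j)) = _
      rw [hWw, hw, Algebra.smul_def]
    refine ⟨W, ?_, ?_⟩
    · by_contra hcon
      push Not at hcon
      apply hf0
      refine LinearMap.ext fun v => ?_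
      rw [hfs]
      simp only [LinearMap.zero_apply]
      refine Finset.sum_eq_zero fun j _ => ?_
      have := (hφ _).2 (hcon j)
      rw [hW] at this
      rw [(mul_eq_zero.1 this).resolve_left hb0, mul_zero]
    · intro g hg
      have hv : (fun j => φ (pderiv j g)) ∈ N := ⟨1, by simp, g, hg, by simp⟩
      have := hf hv
      rw [LinearMap.mem_ker, hfs] at this
      rw [← hφ, map_sum]
      simp only [map_mul, hW]
      calc ∑ j, algebraMap A K (b : A) * f (Pi.single j 1) * φ (pderiv j g)
          = algebraMap A K (b : A) * ∑ j, φ (pderiv j g) * f (Pi.single j 1) := by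
            rw [Finset.mul_sum]; exact Finset.sum_congr rfl fun j _ => by ring
        _ = 0 := by rw [this, mul_zero]

/-- A real algebraic set is a finite union of connected sets. -/
theorem real_alg_finConn {σ : Type*} [Fintype σ] (I : Ideal (MvPolynomial σ ℝ)) :
    FinConn {x : σ → ℝ | ∀ p ∈ I, eval x p = 0} := by
  classical
  induction I using WellFoundedGT.induction with
  | ind I ih =>
  set V := {x : σ → ℝ | ∀ p ∈ I, eval x p = 0} with hV
  have hadd : ∀ a : MvPolynomial σ ℝ, {x : σ → ℝ | ∀ p ∈ I ⊔ Ideal.span {a}, eval x p = 0} =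
      V ∩ {x | eval x a = 0} := by
    intro a
    ext x
    constructor
    · intro h
      exact ⟨fun p hp => h p (Ideal.mem_sup_left hp),
        h a (Ideal.mem_sup_right (Ideal.mem_span_singleton_self a))⟩
    · rintro ⟨h1, h2⟩ p hp
      obtain ⟨u, hu, v, hv, rfl⟩ := Submodule.mem_sup.1 hp
      obtain ⟨c, rfl⟩ := Ideal.mem_span_singleton'.1 hv
      have h2' : eval x a = 0 := h2
      simp [h1 u hu, h2']
  have hlt : ∀ a ∉ I, I < I ⊔ Ideal.span {a} := by
    intro a ha
    refine lt_of_le_of_ne le_sup_left fun h => ha ?_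
    rw [h]
    exact Ideal.mem_sup_right (Ideal.mem_span_singleton_self a)
  have ih' : ∀ a ∉ I, FinConn (V ∩ {x | eval x a = 0}) := by
    intro a ha
    rw [← hadd]
    exact ih _ (hlt a ha)
  by_cases hrad : ∀ p, (∀ x ∈ V, eval x p = 0) → p ∈ I
  swap
  · push Not at hrad
    obtain ⟨p, hp, hpI⟩ := hrad
    have := ih' p hpI
    have e : V ∩ {x | eval x p = 0} = V := inter_eq_left.2 (fun x hx => hp x hx)
    rwa [e] at this
  rcases V.eq_empty_or_nonempty with hemp | ⟨x0, hx0⟩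
  · rw [hemp]; exact finConn_of_preconn isPreconnected_empty
  have htop : I ≠ ⊤ := by
    intro h
    have := hx0 1 (by rw [h]; trivial)
    simp at this
  by_cases hprime : I.IsPrime
  swap
  · have : ∃ a b, a ∉ I ∧ b ∉ I ∧ a * b ∈ I := by
      by_contra hcon
      push Not at hcon
      exact hprime ⟨htop, fun {a b} hab => by
        by_contra h
        push Not at h
        exact hcon a b h.1 h.2 hab⟩
    obtain ⟨a, b, ha, hb, hab⟩ := this
    have hu : V = (V ∩ {x | eval x a = 0}) ∪ (V ∩ {x | eval x b = 0}) := by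
      ext x
      constructor
      · intro hx
        have h1 := hx _ hab
        rw [map_mul, mul_eq_zero] at h1
        exact h1.imp (fun h => ⟨hx, h⟩) (fun h => ⟨hx, h⟩)
      · rintro (h | h) <;> exact h.1
    rw [hu]
    exact (ih' a ha).union (ih' b hb)
  have hVcl : IsClosed V := by
    rw [hV]
    simp only [Set.ofPred_forall]
    exact isClosed_iInter fun p => isClosed_iInter fun _ =>
      isClosed_eq (MvPolynomial.continuous_eval p) continuous_const
  rcases gradient_dichotomy I with h | ⟨W, ⟨j, hj⟩, hW⟩
  · -- the zero-dimensional case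
    choose q hq G hG hqG using h
    have hprod : ∏ j, q j ∉ I := by
      rw [Ideal.IsPrime.prod_mem_iff]
      rintro ⟨i, -, hi⟩
      exact hq i hi
    obtain ⟨x, hx, hxq⟩ : ∃ x ∈ V, eval x (∏ j, q j) ≠ 0 := by
      by_contra hcon
      push Not at hcon
      exact hprod (hrad _ hcon)
    have hxq' : ∀ j, eval x (q j) ≠ 0 := by
      rw [map_prod, Finset.prod_ne_zero_iff] at hxq
      exact fun j => hxq j (Finset.mem_univ j)
    set m := RingHom.ker (eval x : MvPolynomial σ ℝ →+* ℝ) with hm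
    have hIm : I ≤ m := fun p hp => hx p hp
    have hXj : ∀ j, X j - C (x j) ∈ I ⊔ m ^ 2 := by
      intro j
      have h1 := taylor_one x (G j)
      have h2 : ∀ i, eval x (pderiv i (G j)) = if i = j then eval x (q j) else 0 := by
        intro i
        have := hx _ (hqG j i)
        rw [map_sub, sub_eq_zero] at this
        rw [this]
        split_ifs <;> simp
      simp only [h2, hx _ (hG j), map_zero, sub_zero] at h1
      rw [Finset.sum_eq_single j (by intro i _ hi; simp [hi]) (by simp)] at h1
      simp only [if_true] at h1
      have h3 : C (eval x (q j)) * (X j - C (x j)) ∈ I ⊔ m ^ 2 := by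
        have := sub_mem (Ideal.mem_sup_left (hG j) : G j ∈ I ⊔ m ^ 2) (Ideal.mem_sup_right h1)
        simpa using this
      have h4 := Ideal.mul_mem_left _ (C (eval x (q j))⁻¹) h3
      rwa [← mul_assoc, ← C_mul, inv_mul_cancel₀ (hxq' j), C_1, one_mul] at h4
    have hmI : m ≤ I ⊔ m ^ 2 := by
      intro g hg
      have h1 := taylor_one x g
      have hg0 : eval x g = 0 := hg
      rw [hg0, map_zero, sub_zero] at h1
      have h2 : ∑ j, C (eval x (pderiv j g)) * (X j - C (x j)) ∈ I ⊔ m ^ 2 :=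
        sum_mem fun j _ => Ideal.mul_mem_left _ _ (hXj j)
      have := add_mem (Ideal.mem_sup_right h1 : _ ∈ I ⊔ m ^ 2) h2
      simpa using this
    let mb := m.map (Ideal.Quotient.mk I)
    have hidem : IsIdempotentElem mb := by
      apply le_antisymm
      · exact Ideal.mul_le_left
      · have := Ideal.map_mono (f := Ideal.Quotient.mk I) hmI
        rw [Ideal.map_sup, Ideal.map_quotient_self, bot_sup_eq, Ideal.map_pow, pow_two] at this
        exact this
    have hmb : mb = ⊥ ∨ mb = ⊤ :=
      (Ideal.isIdempotentElem_iff_eq_bot_or_top mb (IsNoetherian.noetherian mb)).1 hidem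
    have hmI2 : m ≤ I := by
      rcases hmb with h | h
      · rw [Ideal.map_eq_bot_iff_le_ker, Ideal.mk_ker] at h
        exact h
      · exfalso
        have h1 : (1 : MvPolynomial σ ℝ ⧸ I) ∈ mb := by rw [h]; trivial
        obtain ⟨p, hp, hp1⟩ := (Ideal.mem_map_iff_of_surjective _ Ideal.Quotient.mk_surjective).1 h1
        rw [← map_one (Ideal.Quotient.mk I), Ideal.Quotient.eq] at hp1
        have h3 : eval x (p - 1) = 0 := hIm hp1
        have h4 : eval x p = 0 := hp
        simp [h4] at h3
    have hVs : V = {x} := by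
      apply Subset.antisymm
      · intro y hy
        ext i
        have := hy (X i - C (x i)) (hmI2 (by simp [hm, RingHom.mem_ker]))
        simp only [map_sub, eval_X, eval_C] at this
        linarith
      · rintro _ rfl; exact hx
    rw [hVs]
    exact finConn_of_preconn isPreconnected_singleton
  · -- the positive-dimensional case
    obtain ⟨x, hx, hxj⟩ : ∃ x ∈ V, eval x (W j) ≠ 0 := by
      by_contra hcon
      push Not at hcon
      exact hj (hrad _ hcon)
    let a : σ → ℝ := fun i => x i - if i = j then 1 else 0
    let u : MvPolynomial σ ℝ := ∑ i, (X i - C (a i)) * W i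
    have hu : ∀ y, eval y u = ∑ i, (y i - a i) * eval y (W i) := by
      intro y; simp [u]
    have huI : u ∉ I := by
      intro h
      have := hx u h
      rw [hu] at this
      simp [a] at this
      exact hxj this
    refine finConn_of_meets inter_subset_left (ih' u huI) fun y hy => ?_
    have hcl : IsClosed (connectedComponentIn V y) := by
      refine isClosed_of_closure_subset ?_
      exact isPreconnected_connectedComponentIn.closure.subset_connectedComponentIn
        (subset_closure (mem_connectedComponentIn hy))
        (closure_minimal (connectedComponentIn_subset _ _) hVcl)
    obtain ⟨z, hz, hzmin⟩ := exists_nearest _ hcl ⟨y, mem_connectedComponentIn hy⟩ a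
    have hzV : z ∈ V := connectedComponentIn_subset _ _ hz
    refine ⟨z, hz, hzV, ?_⟩
    have hce := connectedComponentIn_eq hz
    rw [hce] at hzmin
    have h1 := nearest_deriv_nonneg I W hW a z hzV hzmin
    have h2 := nearest_deriv_nonneg I (fun i => - W i)
      (fun g hg => by simpa using hW g hg) a z hzV hzmin
    simp only [map_neg, mul_neg, Finset.sum_neg_distrib] at h2
    change eval z u = 0
    rw [hu]
    linarith
end PartA3

section PartB1
/-- Basic semialgebraic sets: finite intersections of sign conditions. -/
def BasicSA {N : ℕ} (S : Set (CE N)) : Prop :=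
  ∃ (ι : Type) (_ : Fintype ι) (P : ι → MvPolynomial (Fin N ⊕ Fin N) ℝ) (σ : ι → Ordering),
    S = {z | ∀ j, signCond (σ j) (realizeRe (P j) z)}

theorem BasicSA.inter {N : ℕ} {S T : Set (CE N)} (hS : BasicSA S) (hT : BasicSA T) :
    BasicSA (S ∩ T) := by
  obtain ⟨ι, _, P, σ, rfl⟩ := hS
  obtain ⟨κ, _, Q, τ, rfl⟩ := hT
  refine ⟨ι ⊕ κ, inferInstance, Sum.elim P Q, Sum.elim σ τ, ?_⟩
  ext z
  simp only [mem_inter_iff, mem_ofPred_eq, Sum.forall, Sum.elim_inl, Sum.elim_inr]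

theorem basicSA_single {N : ℕ} (P : MvPolynomial (Fin N ⊕ Fin N) ℝ) (c : Ordering) :
    BasicSA {z : CE N | signCond c (realizeRe P z)} :=
  ⟨Unit, inferInstance, fun _ => P, fun _ => c, by ext z; simp⟩

/-- The lifted equation. -/
noncomputable def liftEq {N : ℕ} {ι : Type} (P : MvPolynomial (Fin N ⊕ Fin N) ℝ) (c : Ordering)
    (j : ι) : MvPolynomial ((Fin N ⊕ Fin N) ⊕ ι) ℝ :=
  match c with
  | .lt => X (Sum.inr j) ^ 2 * rename Sum.inl P + 1
  | .eq => rename Sum.inl P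
  | .gt => X (Sum.inr j) ^ 2 * rename Sum.inl P - 1

theorem BasicSA.finConn {N : ℕ} {S : Set (CE N)} (hS : BasicSA S) : FinConn S := by
  obtain ⟨ι, _, P, σ, rfl⟩ := hS
  let Q : ι → MvPolynomial ((Fin N ⊕ Fin N) ⊕ ι) ℝ := fun j => liftEq (P j) (σ j) j
  have h1 := real_alg_finConn (Ideal.span (range Q))
  have hmem : ∀ x : ((Fin N ⊕ Fin N) ⊕ ι) → ℝ, (∀ p ∈ Ideal.span (range Q), eval x p = 0) ↔
      ∀ j, eval x (Q j) = 0 := by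
    intro x
    constructor
    · intro h j
      exact h _ (Ideal.subset_span ⟨j, rfl⟩)
    · intro h p hp
      have : Ideal.span (range Q) ≤ RingHom.ker (eval x) := by
        rw [Ideal.span_le]
        rintro _ ⟨j, rfl⟩
        exact h j
      exact this hp
  simp only [hmem] at h1
  let F : (((Fin N ⊕ Fin N) ⊕ ι) → ℝ) → CE N := fun x i =>
    (x (Sum.inl (Sum.inl i)) : ℂ) + (x (Sum.inl (Sum.inr i)) : ℂ) * Complex.I
  have hF : Continuous F := by
    refine continuous_pi fun i => ?_
    fun_prop
  have hre : ∀ x p, realizeRe p (F x) = eval (fun i => x (Sum.inl i)) p := by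
    intro x p
    unfold realizeRe
    congr 2
    funext i
    rcases i with i | i <;> simp [F]
  have h2 := h1.image hF
  have hQe : ∀ (x : ((Fin N ⊕ Fin N) ⊕ ι) → ℝ) (j : ι), eval x (rename Sum.inl (P j)) = eval (fun i => x (Sum.inl i)) (P j) := by
    intro x j; rw [eval_rename]; rfl
  convert h2 using 1
  ext z
  constructor
  · intro hz
    let t : ι → ℝ := fun j => (Real.sqrt |realizeRe (P j) z|)⁻¹
    let x : ((Fin N ⊕ Fin N) ⊕ ι) → ℝ :=
      Sum.elim (Sum.elim (fun i => (z i).re) (fun i => (z i).im)) t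
    refine ⟨x, fun j => ?_, ?_⟩
    · have hz := hz j
      have e : eval x (rename Sum.inl (P j)) = realizeRe (P j) z := by
        rw [hQe]; rfl
      have ht : t j ^ 2 = |realizeRe (P j) z|⁻¹ := by
        simp [t]
      simp only [Q]
      generalize σ j = c at hz
      rcases c
      · have hz : realizeRe (P j) z < 0 := hz
        simp only [liftEq, map_add, map_mul, map_pow, eval_X, e, map_one]
        change t j ^ 2 * _ + 1 = 0
        rw [ht, abs_of_neg hz, inv_neg, neg_mul, inv_mul_cancel₀ hz.ne]
        ring
      · have hz : realizeRe (P j) z = 0 := hz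
        simp only [liftEq, e, hz]
      · have hz : 0 < realizeRe (P j) z := hz
        simp only [liftEq, map_sub, map_mul, map_pow, eval_X, e, map_one]
        change t j ^ 2 * _ - 1 = 0
        rw [ht, abs_of_pos hz, inv_mul_cancel₀ hz.ne']
        ring
    · funext i
      simp [F, x, Complex.re_add_im]
  · rintro ⟨x, hx, rfl⟩ j
    have hx := hx j
    rw [hre, ← hQe]
    simp only [Q] at hx
    generalize σ j = c at hx
    rcases c
    · simp only [liftEq, map_add, map_mul, map_pow, eval_X, map_one] at hx
      change _ < 0
      by_contra hcon
      push Not at hcon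
      nlinarith [mul_nonneg (sq_nonneg (x (Sum.inr j))) hcon]
    · exact hx
    · simp only [liftEq, map_sub, map_mul, map_pow, eval_X, map_one] at hx
      change 0 < _
      by_contra hcon
      push Not at hcon
      nlinarith [mul_nonneg (sq_nonneg (x (Sum.inr j))) (neg_nonneg.2 hcon)]

theorem exists_re_im {N : ℕ} (p : MvPolynomial (Fin N) ℂ) :
    ∃ a b : MvPolynomial (Fin N ⊕ Fin N) ℝ, ∀ z : CE N,
      realizeRe a z = (eval z p).re ∧ realizeRe b z = (eval z p).im := by
  induction p using MvPolynomial.induction_on with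
  | C c => exact ⟨C c.re, C c.im, fun z => by simp [realizeRe]⟩
  | add p q hp hq =>
    obtain ⟨a, b, h⟩ := hp
    obtain ⟨a', b', h'⟩ := hq
    refine ⟨a + a', b + b', fun z => ?_⟩
    have h := h z
    have h' := h' z
    unfold realizeRe at *
    simp [h, h']
  | mul_X p i hp =>
    obtain ⟨a, b, h⟩ := hp
    refine ⟨a * X (Sum.inl i) - b * X (Sum.inr i), a * X (Sum.inr i) + b * X (Sum.inl i),
      fun z => ?_⟩
    have h := h z
    unfold realizeRe at *
    simp [h, Complex.mul_re, Complex.mul_im]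

theorem exists_normSq {N : ℕ} (p : MvPolynomial (Fin N) ℂ) :
    ∃ a : MvPolynomial (Fin N ⊕ Fin N) ℝ, ∀ z : CE N,
      realizeRe a z = Complex.normSq (eval z p) := by
  obtain ⟨a, b, h⟩ := exists_re_im p
  refine ⟨a * a + b * b, fun z => ?_⟩
  have h := h z
  unfold realizeRe at *
  simp [h, Complex.normSq_apply]

theorem basicSA_ne {N : ℕ} (p : MvPolynomial (Fin N) ℂ) : BasicSA {z : CE N | eval z p ≠ 0} := by
  obtain ⟨a, h⟩ := exists_normSq p
  convert basicSA_single a .gt using 1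
  ext z
  simp [signCond, h, Complex.normSq_pos]

theorem basicSA_zeros {N : ℕ} (J : Ideal (MvPolynomial (Fin N) ℂ)) :
    BasicSA {z : CE N | ∀ p ∈ J, eval z p = 0} := by
  obtain ⟨s, rfl⟩ := IsNoetherian.noetherian J
  choose a h using fun p : MvPolynomial (Fin N) ℂ => exists_normSq p
  convert basicSA_single (∑ p ∈ s, a p) .eq using 1
  ext z
  have e : realizeRe (∑ p ∈ s, a p) z = ∑ p ∈ s, Complex.normSq (eval z p) := by
    rw [← Finset.sum_congr rfl fun p _ => h p z]
    simp [realizeRe]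
  simp only [mem_ofPred_eq, signCond, e]
  rw [Finset.sum_eq_zero_iff_of_nonneg fun p _ => Complex.normSq_nonneg _]
  simp only [Complex.normSq_eq_zero]
  constructor
  · intro h p hp
    exact h p (Submodule.subset_span hp)
  · intro h p hp
    have : Ideal.span (s : Set (MvPolynomial (Fin N) ℂ)) ≤ RingHom.ker (eval z) := by
      rw [Ideal.span_le]
      intro q hq
      exact h q hq
    exact this hp

theorem semialg_cyl_finConn {m : ℕ} {Γ : Set (CE m)} (hΓ : IsSemialgebraic Γ)
    (J : Ideal (MvPolynomial (Fin (m + 1)) ℂ)) (h : MvPolynomial (Fin (m + 1)) ℂ) :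
    FinConn ({z : CE (m + 1) | (∀ p ∈ J, eval z p = 0) ∧ eval z h ≠ 0} ∩ cylOver 1 Γ) := by
  obtain ⟨n, r, P, σ, rfl⟩ := hΓ
  have e : ({z : CE (m + 1) | (∀ p ∈ J, eval z p = 0) ∧ eval z h ≠ 0} ∩
      cylOver 1 (⋃ i, ⋂ j, {z | signCond (σ i j) (realizeRe (P i j) z)})) =
      ⋃ i, (({z : CE (m + 1) | ∀ p ∈ J, eval z p = 0} ∩ {z | eval z h ≠ 0}) ∩
        {z | ∀ j, signCond (σ i j) (realizeRe
          (rename (Sum.map (Fin.castAdd 1) (Fin.castAdd 1)) (P i j)) z)}) := by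
    ext z
    have e1 : ∀ i j, realizeRe (rename (Sum.map (Fin.castAdd 1) (Fin.castAdd 1)) (P i j)) z =
        realizeRe (P i j) (projFst m 1 z) := by
      intro i j
      unfold realizeRe
      rw [eval_rename]
      congr 2
      funext l
      rcases l with l | l <;> simp [projFst]
    simp only [cylOver, mem_inter_iff, mem_ofPred_eq, mem_iUnion, mem_iInter, e1]
    tauto
  rw [e]
  refine FinConn.iUnion fun i => BasicSA.finConn (((basicSA_zeros J).inter (basicSA_ne h)).inter
    ⟨Fin r, inferInstance, _, _, rfl⟩)
end PartB1

section PartC1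
theorem clear_denoms {B K : Type*} [CommRing B] [IsDomain B] [Field K] [Algebra B K]
    [IsFractionRing B K] (p : Polynomial K) : ∃ c : B, c ≠ 0 ∧ ∃ q : Polynomial B,
      q.map (algebraMap B K) = Polynomial.C (algebraMap B K c) * p := by
  obtain ⟨c, hc0, hc⟩ := IsLocalization.integerNormalization_spec (nonZeroDivisors B) p
  refine ⟨c, nonZeroDivisors.ne_zero hc0, _, hc.trans ?_⟩
  rw [Algebra.smul_def, IsScalarTower.algebraMap_apply B K (Polynomial K)]
  rfl

theorem abs_prim {B A : Type*} [CommRing B] [IsDomain B] [IsIntegrallyClosed B] [CharZero B]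
    [CommRing A] [IsDomain A] [Algebra B A] [FaithfulSMul B A] [Module.Finite B A] :
    ∃ θ : A, (∃ δ : B, δ ≠ 0 ∧ ∃ u v : Polynomial B,
        u * minpoly B θ + v * Polynomial.derivative (minpoly B θ) = Polynomial.C δ) ∧
      ∀ a : A, ∃ c : B, c ≠ 0 ∧ ∃ b : Polynomial B, algebraMap B A c * a = Polynomial.aeval θ b := by
  let K := FractionRing B
  let L := FractionRing A
  let _ : Algebra K L := FractionRing.liftAlgebra B L
  have hBKL : IsScalarTower B K L := FractionRing.isScalarTower_liftAlgebra B L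
  have hfin : Module.Finite K L := Module.Finite.of_isLocalization B A (nonZeroDivisors B)
  have hchar : CharZero K := inferInstance
  obtain ⟨α, hα⟩ := Field.exists_primitive_element K L
  obtain ⟨a0, s0, hs0, rfl⟩ := IsFractionRing.div_surjective (A := A) α
  have hIntegral : Algebra.IsIntegral B A := inferInstance
  obtain ⟨r, hr, s1, hs1⟩ := (hIntegral.isIntegral s0).isAlgebraic.exists_nonzero_dvd hs0
  have hs0' : algebraMap A L s0 ≠ 0 := IsFractionRing.to_map_ne_zero_of_mem_nonZeroDivisors hs0
  let θ : A := a0 * s1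
  have hθ : algebraMap A L θ = algebraMap K L (algebraMap B K r) *
      (algebraMap A L a0 / algebraMap A L s0) := by
    rw [← IsScalarTower.algebraMap_apply B K L, IsScalarTower.algebraMap_apply B A L, hs1]
    simp only [θ, map_mul]
    rw [mul_comm (algebraMap A L s0), mul_assoc, mul_div_cancel₀ _ hs0', mul_comm]
  have hr' : algebraMap B K r ≠ 0 := by
    rwa [Ne, FaithfulSMul.algebraMap_eq_zero_iff]
  have htop : IntermediateField.adjoin K {algebraMap A L θ} = ⊤ := by
    rw [← hα]
    apply le_antisymm
    · rw [IntermediateField.adjoin_simple_le_iff, hθ]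
      exact mul_mem (IntermediateField.algebraMap_mem _ _) (IntermediateField.mem_adjoin_simple_self _ _)
    · rw [IntermediateField.adjoin_simple_le_iff]
      have : algebraMap A L a0 / algebraMap A L s0 =
          algebraMap K L (algebraMap B K r)⁻¹ * algebraMap A L θ := by
        rw [hθ, ← mul_assoc, ← map_mul, inv_mul_cancel₀ hr', map_one, one_mul]
      rw [this]
      exact mul_mem (IntermediateField.algebraMap_mem _ _) (IntermediateField.mem_adjoin_simple_self _ _)
  have hθi : IsIntegral B θ := hIntegral.isIntegral θ
  have hmin : minpoly K (algebraMap A L θ) = (minpoly B θ).map (algebraMap B K) :=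
    minpoly.isIntegrallyClosed_eq_field_fractions K L hθi
  have hinjBK : Function.Injective (algebraMap B K) := IsFractionRing.injective B K
  refine ⟨θ, ?_, fun a => ?_⟩
  · have hKi : IsIntegral K (algebraMap A L θ) := IsIntegral.of_finite K _
    have hsep : (minpoly K (algebraMap A L θ)).Separable := (minpoly.irreducible hKi).separable
    obtain ⟨u, v, huv⟩ := hsep
    obtain ⟨c, hc, u', hu'⟩ := clear_denoms (B := B) u
    obtain ⟨d, hd, v', hv'⟩ := clear_denoms (B := B) v
    refine ⟨c * d, mul_ne_zero hc hd, Polynomial.C d * u', Polynomial.C c * v', ?_⟩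
    apply Polynomial.map_injective _ hinjBK
    simp only [Polynomial.map_add, Polynomial.map_mul, hu', hv', Polynomial.map_C, map_mul,
      ← Polynomial.derivative_map, ← hmin]
    linear_combination (Polynomial.C (algebraMap B K c) * Polynomial.C (algebraMap B K d)) * huv
  · have ha : algebraMap A L a ∈ IntermediateField.adjoin K {algebraMap A L θ} := by
      rw [htop]; trivial
    have hKi : IsIntegral K (algebraMap A L θ) := IsIntegral.of_finite K _
    rw [← IntermediateField.mem_toSubalgebra,
      IntermediateField.adjoin_simple_toSubalgebra_of_isAlgebraic hKi.isAlgebraic,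
      Algebra.adjoin_singleton_eq_range_aeval] at ha
    obtain ⟨p, hp⟩ := ha
    obtain ⟨c, hc, b, hb⟩ := clear_denoms (B := B) p
    refine ⟨c, hc, b, ?_⟩
    apply IsFractionRing.injective A L
    have e : algebraMap A L (Polynomial.aeval θ b) =
        Polynomial.aeval (algebraMap A L θ) (b.map (algebraMap B K)) := by
      rw [Polynomial.aeval_map_algebraMap, Polynomial.aeval_algebraMap_apply]
    have hp' : Polynomial.aeval (algebraMap A L θ) p = algebraMap A L a := hp
    rw [e, hb, map_mul, map_mul, Polynomial.aeval_C, hp', ← IsScalarTower.algebraMap_apply B K L,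
      ← IsScalarTower.algebraMap_apply B A L]
end PartC1

section PartC2
/-- Evaluation of a polynomial over a polynomial ring. -/
noncomputable def pev {k : ℕ} (y : Fin k → ℂ) (t : ℂ) :
    Polynomial (MvPolynomial (Fin k) ℂ) →+* ℂ := Polynomial.eval₂RingHom (eval y) t

@[simp] theorem pev_C {k : ℕ} (y : Fin k → ℂ) (t : ℂ) (p : MvPolynomial (Fin k) ℂ) :
    pev y t (Polynomial.C p) = eval y p := by simp [pev]

@[simp] theorem pev_X {k : ℕ} (y : Fin k → ℂ) (t : ℂ) :
    pev y t Polynomial.X = t := by simp [pev]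

/-- A concrete generic étale presentation of an affine variety. -/
structure EtPres {N : ℕ} (q : Ideal (MvPolynomial (Fin N) ℂ)) (h : MvPolynomial (Fin N) ℂ) where
  k : ℕ
  y : Fin k → MvPolynomial (Fin N) ℂ
  θ : MvPolynomial (Fin N) ℂ
  Φ : Polynomial (MvPolynomial (Fin k) ℂ)
  δ : MvPolynomial (Fin k) ℂ
  Ψ : Fin N → Polynomial (MvPolynomial (Fin k) ℂ)
  b : Fin N → Polynomial (MvPolynomial (Fin k) ℂ)
  hΨ : ∀ i, (Ψ i).Monic
  hΨ0 : ∀ x : CE N, (∀ p ∈ q, eval x p = 0) → ∀ i, pev (fun j => eval x (y j)) (x i) (Ψ i) = 0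
  hΦ0 : ∀ x : CE N, (∀ p ∈ q, eval x p = 0) → pev (fun j => eval x (y j)) (eval x θ) Φ = 0
  hΦ' : ∀ y0 t, eval y0 δ ≠ 0 → pev y0 t Φ = 0 → pev y0 t (Polynomial.derivative Φ) ≠ 0
  hsec : ∀ y0 t, eval y0 δ ≠ 0 → pev y0 t Φ = 0 → ∀ x : CE N,
    (∀ i, x i = pev y0 t (b i) / eval y0 δ) →
      (∀ p ∈ q, eval x p = 0) ∧ (∀ j, eval x (y j) = y0 j) ∧ eval x θ = t
  hinv : ∀ x : CE N, (∀ p ∈ q, eval x p = 0) → eval (fun j => eval x (y j)) δ ≠ 0 →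
    ∀ i, x i = pev (fun j => eval x (y j)) (eval x θ) (b i) / eval (fun j => eval x (y j)) δ
  hh : ∀ x : CE N, (∀ p ∈ q, eval x p = 0) → eval (fun j => eval x (y j)) δ ≠ 0 → eval x h ≠ 0
  hδ : bind₁ y δ ∉ q

theorem etPres_aux {N k : ℕ} (q : Ideal (MvPolynomial (Fin N) ℂ))
    (h : MvPolynomial (Fin N) ℂ) (hh : h ∉ q) {A : Type} [CommRing A] [IsDomain A]
    [Algebra (MvPolynomial (Fin k) ℂ) A] [FaithfulSMul (MvPolynomial (Fin k) ℂ) A]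
    [Module.Finite (MvPolynomial (Fin k) ℂ) A] (mk : MvPolynomial (Fin N) ℂ →+* A)
    (hmks : Function.Surjective mk) (hmk0 : ∀ p, mk p = 0 ↔ p ∈ q)
    (hC : ∀ a : ℂ, mk (C a) = algebraMap (MvPolynomial (Fin k) ℂ) A (C a)) :
    Nonempty (EtPres q h) := by
  classical
  let g : (MvPolynomial (Fin k) ℂ) →+* A := algebraMap (MvPolynomial (Fin k) ℂ) A
  have hginj : Function.Injective g := FaithfulSMul.algebraMap_injective (MvPolynomial (Fin k) ℂ) A
  have hmap : ∀ p : (MvPolynomial (Fin k) ℂ), algebraMap (MvPolynomial (Fin k) ℂ) A p = g p := fun _ => rfl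
  obtain ⟨θ, ⟨δ0, hδ0, u, v, huv⟩, hgen⟩ := abs_prim (B := MvPolynomial (Fin k) ℂ) (A := A)
  obtain ⟨θh, hθh⟩ := hmks θ
  choose y hy using fun j : Fin k => hmks (g (X j))
  choose c hc b' hb' using fun i : Fin N => hgen (mk (X i))
  have hIntegral : Algebra.IsIntegral (MvPolynomial (Fin k) ℂ) A := inferInstance
  obtain ⟨ch, hch, ah, hah⟩ := (hIntegral.isIntegral (mk h)).isAlgebraic.exists_nonzero_dvd
    (mem_nonZeroDivisors_of_ne_zero (fun e => hh ((hmk0 h).1 e)))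
  obtain ⟨δ, hδd⟩ : ∃ δ : MvPolynomial (Fin k) ℂ, δ = δ0 * ch * ∏ i, c i := ⟨_, rfl⟩
  have hδne : δ ≠ 0 := hδd ▸ mul_ne_zero (mul_ne_zero hδ0 hch) (Finset.prod_ne_zero_iff.2 fun i _ => hc i)
  let b : Fin N → Polynomial (MvPolynomial (Fin k) ℂ) := fun i =>
    Polynomial.C (δ0 * ch * ∏ j ∈ Finset.univ.erase i, c j) * b' i
  have hb : ∀ i, Polynomial.aeval θ (b i) = g δ * mk (X i) := by
    intro i
    simp only [b, map_mul (Polynomial.aeval θ), ← hb', Polynomial.aeval_C]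
    rw [hmap, hmap, ← mul_assoc, ← map_mul]
    congr 2
    rw [hδd]
    rw [← Finset.prod_erase_mul _ _ (Finset.mem_univ i)]
    ring
  clear_value b
  -- evaluation at a point
  have hyq : ∀ p : (MvPolynomial (Fin k) ℂ), mk (bind₁ y p) = g p := by
    intro p
    have : mk.comp (bind₁ y).toRingHom = g := by
      apply MvPolynomial.ringHom_ext
      · intro a
        simpa using hC a
      · intro j
        simpa using hy j
    exact DFunLike.congr_fun this p
  have hev : ∀ x : CE N, ∀ hx : (∀ p ∈ q, eval x p = 0), ∃ e : A →+* ℂ, (∀ p, e (mk p) = eval x p) ∧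
      (∀ p, e (g p) = eval (fun j => eval x (y j)) p) ∧
      ∀ a Q, e (Polynomial.aeval a Q) = pev (fun j => eval x (y j)) (e a) Q := by
    intro x hx
    have hker : RingHom.ker mk ≤ RingHom.ker (eval x : (MvPolynomial (Fin N) ℂ) →+* ℂ) := fun p hp => hx p ((hmk0 p).1 hp)
    let e : A →+* ℂ := mk.liftOfSurjective hmks ⟨eval x, hker⟩
    have e1 : ∀ p, e (mk p) = eval x p := fun p =>
      RingHom.liftOfRightInverse_comp_apply _ _ _ ⟨eval x, hker⟩ p
    have e2 : ∀ p, e (g p) = eval (fun j => eval x (y j)) p := by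
      intro p
      rw [← hyq, e1, ← MvPolynomial.coe_aeval_eq_eval, ← MvPolynomial.coe_aeval_eq_eval]
      exact aeval_bind₁ _ _ _
    refine ⟨e, e1, e2, fun a Q => ?_⟩
    rw [Polynomial.aeval_def, Polynomial.hom_eval₂, pev, Polynomial.coe_eval₂RingHom]
    congr 1
    exact RingHom.ext e2
  have hθi : IsIntegral (MvPolynomial (Fin k) ℂ) θ := hIntegral.isIntegral θ
  have H : ∀ p : (MvPolynomial (Fin N) ℂ), ∃ M : ℕ, ∃ G : Polynomial (MvPolynomial (Fin k) ℂ), Polynomial.aeval θ G = g δ ^ M * mk p ∧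
      ∀ y0 t, eval y0 δ ≠ 0 → pev y0 t G = eval y0 δ ^ M *
        eval (fun i => pev y0 t (b i) / eval y0 δ) p := by
    intro p
    induction p using MvPolynomial.induction_on with
    | C a =>
      refine ⟨0, Polynomial.C (C a), ?_, fun y0 t _ => by simp⟩
      rw [Polynomial.aeval_C, hmap, pow_zero, one_mul]
      exact (hC a).symm
    | add p p' hp hp' =>
      obtain ⟨M, G, h1, h2⟩ := hp
      obtain ⟨M', G', h1', h2'⟩ := hp'
      refine ⟨M + M', Polynomial.C (δ ^ M') * G + Polynomial.C (δ ^ M) * G', ?_, fun y0 t h0 => ?_⟩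
      · simp only [map_add, map_mul (Polynomial.aeval θ), Polynomial.aeval_C, hmap, h1, h1', map_pow]
        ring
      · simp only [map_add, map_mul, pev_C, h2 y0 t h0, h2' y0 t h0, map_pow]
        ring
    | mul_X p i hp =>
      obtain ⟨M, G, h1, h2⟩ := hp
      refine ⟨M + 1, G * b i, ?_, fun y0 t h0 => ?_⟩
      · rw [map_mul, h1, hb, map_mul]; ring
      · rw [map_mul, h2 y0 t h0, map_mul, eval_X]
        field_simp
        ring
  have H' : ∀ (p : (MvPolynomial (Fin N) ℂ)) (Q : Polynomial (MvPolynomial (Fin k) ℂ)), Polynomial.aeval θ Q = mk p → ∀ y0 t, eval y0 δ ≠ 0 →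
      pev y0 t (minpoly (MvPolynomial (Fin k) ℂ) θ) = 0 →
      eval (fun i => pev y0 t (b i) / eval y0 δ) p = pev y0 t Q := by
    intro p Q hQ y0 t h0 ht
    obtain ⟨M, G, h1, h2⟩ := H p
    have h3 : Polynomial.aeval θ (G - Polynomial.C (δ ^ M) * Q) = 0 := by
      rw [map_sub, h1, map_mul, Polynomial.aeval_C, hmap, hQ, map_pow, sub_self]
    obtain ⟨Z, hZ⟩ := minpoly.isIntegrallyClosed_dvd hθi h3
    have h4 : pev y0 t (G - Polynomial.C (δ ^ M) * Q) = 0 := by rw [hZ, map_mul, ht, zero_mul]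
    rw [map_sub, h2 y0 t h0, map_mul, pev_C, map_pow, ← mul_sub] at h4
    exact sub_eq_zero.1 ((mul_eq_zero.1 h4).resolve_left (pow_ne_zero _ h0))
  refine ⟨{ k := k, y := y, θ := θh, Φ := minpoly (MvPolynomial (Fin k) ℂ) θ, δ := δ, Ψ := fun i => minpoly (MvPolynomial (Fin k) ℂ) (mk (X i)),
            b := b, hΨ := fun i => minpoly.monic (hIntegral.isIntegral _), hΨ0 := ?_, hΦ0 := ?_,
            hΦ' := ?_, hsec := ?_, hinv := ?_, hh := ?_, hδ := ?_ }⟩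
  · intro x hx i
    obtain ⟨e, e1, e2, e3⟩ := hev x hx
    have := e3 (mk (X i)) (minpoly (MvPolynomial (Fin k) ℂ) (mk (X i)))
    rw [minpoly.aeval, map_zero, e1, eval_X] at this
    exact this.symm
  · intro x hx
    obtain ⟨e, e1, e2, e3⟩ := hev x hx
    have := e3 θ (minpoly (MvPolynomial (Fin k) ℂ) θ)
    rw [minpoly.aeval, map_zero, ← hθh, e1] at this
    rw [← hθh]
    exact this.symm
  · intro y0 t h0 ht hcon
    have := congrArg (pev y0 t) huv
    rw [map_add, map_mul, map_mul, ht, hcon, mul_zero, mul_zero, add_zero, pev_C] at this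
    apply h0
    simp only [hδd, map_mul, ← this, zero_mul]
  · intro y0 t h0 ht x hx
    have hx' : x = fun i => pev y0 t (b i) / eval y0 δ := funext hx
    subst hx'
    refine ⟨fun p hp => ?_, fun j => ?_, ?_⟩
    · have := H' p 0 (by rw [map_zero, (hmk0 p).2 hp]) y0 t h0 ht
      rw [this, map_zero]
    · have := H' (y j) (Polynomial.C (X j)) (by rw [Polynomial.aeval_C, hmap, hy]) y0 t h0 ht
      rw [this, pev_C, eval_X]
    · have := H' θh Polynomial.X (by rw [Polynomial.aeval_X, hθh]) y0 t h0 ht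
      rw [this, pev_X]
  · intro x hx h0 i
    obtain ⟨e, e1, e2, e3⟩ := hev x hx
    have := e3 θ (b i)
    rw [hb, map_mul, e2, e1, eval_X, ← hθh, e1] at this
    rw [← this]
    field_simp
  · intro x hx h0 hcon
    obtain ⟨e, e1, e2, e3⟩ := hev x hx
    have := congrArg e hah
    rw [hmap, map_mul, e2, e1, hcon, zero_mul] at this
    apply h0
    simp only [hδd, map_mul, this, mul_zero, zero_mul]
  · rw [← hmk0, hyq]
    intro hcon
    exact hδne (hginj (by rw [hcon, map_zero]))

theorem exists_etPres {N : ℕ} (q : Ideal (MvPolynomial (Fin N) ℂ)) [hq : q.IsPrime]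
    (h : MvPolynomial (Fin N) ℂ) (hh : h ∉ q) : Nonempty (EtPres q h) := by
  obtain ⟨k, g, hginj, hgfin⟩ := exists_finite_inj_algHom_of_fg ℂ (MvPolynomial (Fin N) ℂ ⧸ q)
  let al : Algebra (MvPolynomial (Fin k) ℂ) (MvPolynomial (Fin N) ℂ ⧸ q) := g.toRingHom.toAlgebra
  have hfaith : @FaithfulSMul (MvPolynomial (Fin k) ℂ) (MvPolynomial (Fin N) ℂ ⧸ q) al.toSMul :=
    (@faithfulSMul_iff_algebraMap_injective (MvPolynomial (Fin k) ℂ) (MvPolynomial (Fin N) ℂ ⧸ q)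
      _ _ al).2 hginj
  have hfin : @Module.Finite (MvPolynomial (Fin k) ℂ) (MvPolynomial (Fin N) ℂ ⧸ q) _ _
    al.toModule := hgfin
  exact @etPres_aux N k q h hh (MvPolynomial (Fin N) ℂ ⧸ q) _ _ al hfaith hfin
    (Ideal.Quotient.mk q) Ideal.Quotient.mk_surjective
    (fun p => Ideal.Quotient.eq_zero_iff_mem) (fun a => (g.commutes a).symm)
end PartC2

section PartH1
theorem local_taylor_bound {E : Type*} [NormedAddCommGroup E] [NormedSpace ℂ E] {F : E → ℂ} {x0 : E}
    (hF : AnalyticAt ℂ F x0) : ∃ ρ : ℝ, 0 < ρ ∧ ∃ S : ℝ, ∀ᶠ x in 𝓝 x0,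
      (∀ n : ℕ, ‖iteratedFDeriv ℂ n F x‖ * ρ ^ n ≤ n.factorial * S) ∧
      ∀ y, ‖y‖ < ρ → HasSum (fun n : ℕ => ((n.factorial : ℂ)⁻¹) • iteratedFDeriv ℂ n F x (fun _ => y))
        (F (x + y)) := by
  obtain ⟨p, r, hp⟩ := hF
  obtain ⟨ρ2, h0, hρ2⟩ : ∃ ρ2 : NNReal, 0 < ρ2 ∧ (ρ2 : ENNReal) < r := by
    obtain ⟨a, ha0, ha⟩ := ENNReal.lt_iff_exists_nnreal_btwn.1 hp.r_pos
    exact ⟨a, by exact_mod_cast ha0, ha⟩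
  let ρ : NNReal := ρ2 / 2
  have hρ0 : 0 < ρ := half_pos h0
  have hρρ : ρ + ρ = ρ2 := add_halves ρ2
  have hsum : ((ρ : ENNReal) + ρ) < p.radius := by
    rw [← ENNReal.coe_add, hρρ]
    exact lt_of_lt_of_le hρ2 hp.r_le
  have hs := p.changeOriginSeries_summable_aux₁ hsum
  let S : NNReal := ∑' s : Σ k l : ℕ, { s : Finset (Fin (k + l)) // s.card = l },
      ‖p (s.1 + s.2.1)‖₊ * ρ ^ s.2.1 * ρ ^ s.1
  refine ⟨ρ, hρ0, S, ?_⟩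
  have hρr : (ρ : ENNReal) < r := lt_of_le_of_lt (by
    rw [← hρρ]; push_cast; exact le_self_add) hρ2
  filter_upwards [Metric.ball_mem_nhds x0 (show (0 : ℝ) < ρ from hρ0)] with x hx
  have hy : ‖x - x0‖₊ < ρ := by
    rw [← NNReal.coe_lt_coe, coe_nnnorm, ← dist_eq_norm]; exact hx
  have hy' : (‖x - x0‖₊ : ENNReal) < r := lt_trans (by exact_mod_cast hy) hρr
  have hq := hp.changeOrigin hy'
  rw [add_sub_cancel] at hq
  have hD : ∀ (n : ℕ) (v : Fin n → E), iteratedFDeriv ℂ n F x v = _ := fun n v =>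
    hq.iteratedFDeriv_eq_sum_of_completeSpace v
  have hnorm : ∀ n : ℕ, ‖iteratedFDeriv ℂ n F x‖ ≤
      n.factorial * ‖p.changeOrigin (x - x0) n‖ := by
    intro n
    refine ContinuousMultilinearMap.opNorm_le_bound (by positivity) fun v => ?_
    rw [hD]
    refine (norm_sum_le _ _).trans ?_
    refine (Finset.sum_le_sum (g := fun _ => ‖p.changeOrigin (x - x0) n‖ * ∏ i, ‖v i‖)
      fun σ _ => ?_).trans ?_
    · refine (ContinuousMultilinearMap.le_opNorm _ _).trans_eq ?_
      rw [Equiv.prod_comp σ (fun i => ‖v i‖)]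
    · simp [Finset.card_univ, Fintype.card_perm, mul_assoc]
  constructor
  · intro n
    have h1 : ‖p.changeOrigin (x - x0) n‖₊ * ρ ^ n ≤ S := by
      have h2 := p.nnnorm_changeOrigin_le n (lt_of_lt_of_le hy' hp.r_le)
      have h3 := (NNReal.summable_sigma.1 hs)
      calc ‖p.changeOrigin (x - x0) n‖₊ * ρ ^ n
          ≤ (∑' s : Σ l : ℕ, { s : Finset (Fin (n + l)) // s.card = l },
              ‖p (n + s.1)‖₊ * ‖x - x0‖₊ ^ s.1) * ρ ^ n := by gcongr
        _ = ∑' s : Σ l : ℕ, { s : Finset (Fin (n + l)) // s.card = l },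
              ‖p (n + s.1)‖₊ * ‖x - x0‖₊ ^ s.1 * ρ ^ n := by rw [_root_.tsum_mul_right]
        _ ≤ ∑' s : Σ l : ℕ, { s : Finset (Fin (n + l)) // s.card = l },
              ‖p (n + s.1)‖₊ * ρ ^ s.1 * ρ ^ n := by
            have hle : ∀ s : Σ l : ℕ, { s : Finset (Fin (n + l)) // s.card = l },
              ‖p (n + s.1)‖₊ * ‖x - x0‖₊ ^ s.1 * ρ ^ n ≤ ‖p (n + s.1)‖₊ * ρ ^ s.1 * ρ ^ n := by
              intro s; gcongr
            exact Summable.tsum_le_tsum hle (NNReal.summable_of_le hle (h3.1 n)) (h3.1 n)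
        _ ≤ S := by
            simp only [S]
            rw [hs.tsum_sigma' (fun b => h3.1 b)]
            exact h3.2.le_tsum n (fun _ _ => zero_le)
    have h1' : ‖p.changeOrigin (x - x0) n‖ * (ρ : ℝ) ^ n ≤ S := by exact_mod_cast h1
    calc ‖iteratedFDeriv ℂ n F x‖ * (ρ : ℝ) ^ n
        ≤ (n.factorial * ‖p.changeOrigin (x - x0) n‖) * (ρ : ℝ) ^ n := by gcongr; exact hnorm n
      _ ≤ n.factorial * S := by rw [mul_assoc]; gcongr
  · intro y hyρ
    have hymem : y ∈ Metric.eball (0 : E) (r - ‖x - x0‖₊) := by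
      rw [Metric.mem_eball, edist_zero_right]
      refine lt_tsub_iff_right.2 ?_
      refine lt_of_lt_of_le ?_ hρ2.le
      rw [← hρρ, enorm_eq_nnnorm, ← ENNReal.coe_add, ENNReal.coe_lt_coe]
      exact add_lt_add (by exact_mod_cast hyρ) hy
    have := hq.hasSum hymem
    refine this.congr_fun fun n => ?_
    rw [hD]
    simp only [Finset.sum_const, Finset.card_univ, Fintype.card_perm, Fintype.card_fin]
    rw [← Nat.cast_smul_eq_nsmul ℂ, smul_smul, inv_mul_cancel₀, one_smul]
    exact_mod_cast n.factorial_ne_zero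
end PartH1

section PartH2
theorem analyticAt_param_integral {E : Type*} [NormedAddCommGroup E] [NormedSpace ℂ E]
    {F : E → ℂ} {c : ℝ → E} (hc : Continuous c) {a b : ℝ} (hab : a ≤ b) {p : E}
    (hF : ∀ t ∈ Icc a b, AnalyticAt ℂ F (p + c t)) :
    AnalyticAt ℂ (fun x => ∫ t in a..b, F (x + c t)) p := by
  have huni : ∃ ρ : ℝ, 0 < ρ ∧ ∃ S : ℝ, ∀ t ∈ Icc a b,
      (∀ n : ℕ, ‖iteratedFDeriv ℂ n F (p + c t)‖ * ρ ^ n ≤ n.factorial * S) ∧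
      ∀ y, ‖y‖ < ρ → HasSum (fun n : ℕ => ((n.factorial : ℂ)⁻¹) •
        iteratedFDeriv ℂ n F (p + c t) (fun _ => y)) (F (p + c t + y)) := by
    refine (isCompact_Icc (a := a) (b := b)).induction_on
      (p := fun s => ∃ ρ : ℝ, 0 < ρ ∧ ∃ S : ℝ, ∀ t ∈ s,
      (∀ n : ℕ, ‖iteratedFDeriv ℂ n F (p + c t)‖ * ρ ^ n ≤ n.factorial * S) ∧
      ∀ y, ‖y‖ < ρ → HasSum (fun n : ℕ => ((n.factorial : ℂ)⁻¹) •
        iteratedFDeriv ℂ n F (p + c t) (fun _ => y)) (F (p + c t + y))) ?_ ?_ ?_ ?_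
    · exact ⟨1, one_pos, 0, by simp⟩
    · rintro s t hst ⟨ρ, h0, S, h⟩
      exact ⟨ρ, h0, S, fun x hx => h x (hst hx)⟩
    · rintro s t ⟨ρ, h0, S, h⟩ ⟨ρ', h0', S', h'⟩
      refine ⟨min ρ ρ', lt_min h0 h0', max S S', ?_⟩
      have hm := lt_min h0 h0'
      rintro x (hx | hx)
      · refine ⟨fun n => ?_, fun y hy => (h x hx).2 y (hy.trans_le (min_le_left _ _))⟩
        calc _ ≤ ‖iteratedFDeriv ℂ n F (p + c x)‖ * ρ ^ n := by gcongr; exact min_le_left _ _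
          _ ≤ n.factorial * S := (h x hx).1 n
          _ ≤ _ := by gcongr; exact le_max_left _ _
      · refine ⟨fun n => ?_, fun y hy => (h' x hx).2 y (hy.trans_le (min_le_right _ _))⟩
        calc _ ≤ ‖iteratedFDeriv ℂ n F (p + c x)‖ * ρ' ^ n := by gcongr; exact min_le_right _ _
          _ ≤ n.factorial * S' := (h' x hx).1 n
          _ ≤ _ := by gcongr; exact le_max_right _ _
    · intro t ht
      obtain ⟨ρ, h0, S, h⟩ := local_taylor_bound (hF t ht)
      have hct : Tendsto (fun t => p + c t) (𝓝 t) (𝓝 (p + c t)) :=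
        (continuous_const.add hc).tendsto t
      have := hct.eventually h
      exact ⟨_, nhdsWithin_le_nhds this, ρ, h0, S, fun x hx => hx⟩
  obtain ⟨ρ, h0, S, hS⟩ := huni
  have hcont : ∀ n : ℕ, ContinuousOn (fun t => iteratedFDeriv ℂ n F (p + c t)) (Icc a b) := by
    intro n t ht
    have h1 : ContinuousAt (iteratedFDeriv ℂ n F) (p + c t) := by
      obtain ⟨U, hU, hFU⟩ := (hF t ht).exists_mem_nhds_analyticOnNhd
      exact (AnalyticOnNhd.iteratedFDeriv hFU n _ (mem_of_mem_nhds hU)).continuousAt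
    have h2 : ContinuousAt (fun t => p + c t) t := (continuous_const.add hc).continuousAt
    exact (ContinuousAt.comp (f := fun t => p + c t) h1 h2).continuousWithinAt
  have hIntegral : ∀ n : ℕ, IntervalIntegrable (fun t => iteratedFDeriv ℂ n F (p + c t))
      MeasureTheory.volume a b := fun n =>
    ContinuousOn.intervalIntegrable (by rw [uIcc_of_le hab]; exact hcont n)
  let q : FormalMultilinearSeries ℂ E ℂ := fun n =>
    ((n.factorial : ℂ)⁻¹) • ∫ t in a..b, iteratedFDeriv ℂ n F (p + c t)
  have hbd : ∀ n : ℕ, ∀ t ∈ Icc a b, ‖iteratedFDeriv ℂ n F (p + c t)‖ ≤ n.factorial * S / ρ ^ n := by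
    intro n t ht
    rw [le_div_iff₀ (by positivity)]
    exact (hS t ht).1 n
  have happ : ∀ n y, q n (fun _ => y) =
      ∫ t in a..b, ((n.factorial : ℂ)⁻¹) • iteratedFDeriv ℂ n F (p + c t) (fun _ => y) := by
    intro n y
    simp only [q]
    rw [_root_.smul_apply, intervalIntegral.integral_smul]
    congr 1
    exact ((ContinuousMultilinearMap.apply ℂ (fun _ : Fin n => E) ℂ
      (fun _ => y)).intervalIntegral_comp_comm (hIntegral n)).symm
  have hq : HasFPowerSeriesOnBall (fun x => ∫ t in a..b, F (x + c t)) q p (ENNReal.ofReal ρ) := by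
    refine ⟨?_, by simpa using h0, ?_⟩
    · refine q.le_radius_of_bound (r := ρ.toNNReal) ((b - a) * S) (fun n => ?_) |>.trans' ?_
      · simp only [q, norm_smul]
        have h1 : ‖∫ t in a..b, iteratedFDeriv ℂ n F (p + c t)‖ ≤ (n.factorial * S / ρ ^ n) * |b - a| :=
          intervalIntegral.norm_integral_le_of_norm_le_const fun t ht => hbd n t (by
            rw [uIoc_of_le hab] at ht; exact Ioc_subset_Icc_self ht)
        rw [abs_of_nonneg (sub_nonneg.2 hab)] at h1
        have hn : (0 : ℝ) < n.factorial := by positivity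
        have hr : (0 : ℝ) < ρ ^ n := by positivity
        calc _ ≤ ‖((n.factorial : ℂ)⁻¹)‖ * ((n.factorial * S / ρ ^ n) * (b - a)) * ρ ^ n := by
              rw [Real.coe_toNNReal _ h0.le]
              gcongr
          _ = (b - a) * S := by
              rw [norm_inv, Complex.norm_natCast]; field_simp
      · exact le_rfl
    · intro y hy
      have hy' : ‖y‖ < ρ := by
        rw [Metric.mem_eball, edist_zero_right, ← ofReal_norm] at hy
        exact (ENNReal.ofReal_lt_ofReal_iff h0).1 hy
      simp only [happ]
      refine intervalIntegral.hasSum_integral_of_dominated_convergence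
        (fun n _ => S * (‖y‖ / ρ) ^ n) (fun n => ?_) (fun n => ?_) ?_ ?_ ?_
      · have h1 : ContinuousOn (fun t => ((n.factorial : ℂ)⁻¹) •
            iteratedFDeriv ℂ n F (p + c t) (fun _ => y)) (uIcc a b) := by
          rw [uIcc_of_le hab]
          exact (((ContinuousMultilinearMap.apply ℂ (fun _ : Fin n => E) ℂ
            (fun _ => y)).continuous.comp_continuousOn (hcont n))).const_smul ((n.factorial : ℂ)⁻¹)
        exact by
          have h2 := (h1.mono uIoc_subset_uIcc).aestronglyMeasurable measurableSet_uIoc (μ := MeasureTheory.volume)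
          exact h2
      · refine MeasureTheory.ae_of_all _ fun t ht => ?_
        have ht' : t ∈ Icc a b := by rw [uIoc_of_le hab] at ht; exact Ioc_subset_Icc_self ht
        rw [norm_smul, norm_inv, Complex.norm_natCast]
        have h2 := (iteratedFDeriv ℂ n F (p + c t)).le_opNorm (fun _ => y)
        have h3 := hbd n t ht'
        have hn : (0 : ℝ) < n.factorial := by positivity
        simp only [Finset.prod_const, Finset.card_univ, Fintype.card_fin] at h2
        calc _ ≤ (n.factorial : ℝ)⁻¹ * ((n.factorial * S / ρ ^ n) * ‖y‖ ^ n) := by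
              gcongr; exact h2.trans (by gcongr)
          _ = _ := by rw [div_pow]; field_simp
      · refine MeasureTheory.ae_of_all _ fun t ht => ?_
        exact (summable_geometric_of_lt_one (by positivity) ((div_lt_one h0).2 hy')).mul_left _
      · exact intervalIntegrable_const
      · refine MeasureTheory.ae_of_all _ fun t ht => ?_
        have ht' : t ∈ Icc a b := by rw [uIoc_of_le hab] at ht; exact Ioc_subset_Icc_self ht
        have := (hS t ht').2 y hy'
        rwa [add_right_comm] at this
  exact hq.analyticAt
end PartH2

section PartH3
theorem removable_finite {f : ℂ → ℂ} {M : ℝ} (Z : Finset ℂ) : ∀ {U : Set ℂ}, IsOpen U →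
    DifferentiableOn ℂ f (U \ Z) → (∀ z ∈ U \ (Z : Set ℂ), ‖f z‖ ≤ M) →
    ∃ h : ℂ → ℂ, DifferentiableOn ℂ h U ∧ ∀ z ∈ U \ (Z : Set ℂ), h z = f z := by
  classical
  induction Z using Finset.induction_on with
  | empty => 
    intro U hU hd hM
    exact ⟨f, by simpa using hd, fun _ _ => rfl⟩
  | insert a Z ha ih =>
    intro U hU hd hM
    have hset : (U \ {a}) \ (Z : Set ℂ) = U \ ((insert a Z : Finset ℂ) : Set ℂ) := by
      ext z; simp only [Set.mem_sdiff, mem_singleton_iff, Finset.mem_coe, Finset.mem_insert]; tauto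
    obtain ⟨h0, h1, h2⟩ := ih (U := U \ {a}) (hU.sdiff isClosed_singleton)
      (by rw [hset]; exact hd) (by rw [hset]; exact hM)
    rw [hset] at h2
    by_cases haU : a ∈ U
    swap
    · refine ⟨h0, ?_, h2⟩
      rwa [sdiff_singleton_eq_self haU] at h1
    have hset2 : (U \ (Z : Set ℂ)) \ {a} = U \ ((insert a Z : Finset ℂ) : Set ℂ) := by
      ext z; simp only [Set.mem_sdiff, mem_singleton_iff, Finset.mem_coe, Finset.mem_insert]; tauto
    have hs : U \ (Z : Set ℂ) ∈ 𝓝 a :=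
      (hU.sdiff Z.finite_toSet.isClosed).mem_nhds ⟨haU, by simpa using ha⟩
    have h3 := Complex.differentiableOn_update_limUnder_of_bddAbove (f := h0) hs
      (h1.mono (by intro z hz; exact ⟨hz.1.1, hz.2⟩)) ⟨M, by
        rintro _ ⟨z, hz, rfl⟩
        rw [hset2] at hz
        simp only [Function.comp, h2 z hz]
        exact hM z hz⟩
    refine ⟨Function.update h0 a (limUnder (𝓝[≠] a) h0), fun z hz => ?_, fun z hz => ?_⟩
    · by_cases hza : z = a
      · subst hza
        exact (h3.differentiableAt hs).differentiableWithinAt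
      · have := (h1.differentiableAt ((hU.sdiff isClosed_singleton).mem_nhds
          (show z ∈ U \ {a} from ⟨hz, hza⟩)))
        refine (this.congr_of_eventuallyEq ?_).differentiableWithinAt
        filter_upwards [isOpen_compl_singleton.mem_nhds hza] with w hw
        exact Function.update_of_ne hw _ _
    · rw [Function.update_of_ne, h2 z hz]
      rintro rfl
      exact hz.2 (by simp)

/-- Restriction of a polynomial to a line. -/
noncomputable def linePoly {N : ℕ} (x v : CE N) (g : MvPolynomial (Fin N) ℂ) : Polynomial ℂ :=
  aeval (fun i => Polynomial.C (x i) + Polynomial.X * Polynomial.C (v i)) g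

theorem linePoly_eval {N : ℕ} (x v : CE N) (g : MvPolynomial (Fin N) ℂ) (s : ℂ) :
    (linePoly x v g).eval s = eval (x + s • v) g := by
  have : (Polynomial.evalRingHom s).comp (aeval (R := ℂ)
      (fun i => Polynomial.C (x i) + Polynomial.X * Polynomial.C (v i))).toRingHom
      = eval (x + s • v) := by
    apply MvPolynomial.ringHom_ext
    · intro r; simp
    · intro i; simp; ring
  exact congrArg (fun φ : MvPolynomial (Fin N) ℂ →+* ℂ => φ g) this

theorem exists_eval_ne_zero {N : ℕ} {g : MvPolynomial (Fin N) ℂ} (hg : g ≠ 0) :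
    ∃ x : CE N, eval x g ≠ 0 := by
  by_contra! h
  exact hg (MvPolynomial.funext fun x => by rw [h x, map_zero])

theorem continuous_eval_mv {N : ℕ} (g : MvPolynomial (Fin N) ℂ) :
    Continuous fun x : CE N => eval x g := MvPolynomial.continuous_eval g

theorem riemann_ext {N : ℕ} {g : MvPolynomial (Fin N) ℂ} (hg : g ≠ 0) {O : Set (CE N)}
    (hO : IsOpen O) {Ψ : CE N → ℂ} (hΨ : ∀ x ∈ O, eval x g ≠ 0 → AnalyticAt ℂ Ψ x) {M : ℝ}
    (hM : ∀ x ∈ O, eval x g ≠ 0 → ‖Ψ x‖ ≤ M) {p : CE N} (hp : p ∈ O) :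
    ∃ F : CE N → ℂ, AnalyticAt ℂ F p ∧ ∀ᶠ x in 𝓝 p, eval x g ≠ 0 → F x = Ψ x := by
  obtain ⟨x1, hx1⟩ := exists_eval_ne_zero hg
  obtain ⟨v, hv⟩ : ∃ v, v = x1 - p := ⟨_, rfl⟩
  have hpoly : linePoly p v g ≠ 0 := by
    intro h
    have := linePoly_eval p v g 1
    rw [h, hv] at this
    simp at this
    exact hx1 this.symm
  obtain ⟨ε, hε, hεO⟩ : ∃ ε > 0, ∀ s : ℂ, ‖s‖ < ε → p + s • v ∈ O := by
    have hc : Continuous fun s : ℂ => p + s • v := by fun_prop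
    have := (hO.preimage hc).mem_nhds (show (0 : ℂ) ∈ _ by simpa using hp)
    obtain ⟨ε, hε, h⟩ := Metric.mem_nhds_iff.1 this
    exact ⟨ε, hε, fun s hs => h (by simpa using hs)⟩
  obtain ⟨r, hr, hrZ⟩ : ∃ r ∈ Ioo 0 ε, r ∉ (fun s : ℂ => ‖s‖) '' ((linePoly p v g).roots.toFinset : Set ℂ) :=
    (Ioo_infinite hε).exists_notMem_finite ((Finset.finite_toSet _).image _)
  have hsph : ∀ s : ℂ, ‖s‖ = r → eval (p + s • v) g ≠ 0 := by
    intro s hs h0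
    refine hrZ ⟨s, ?_, hs⟩
    simp only [Finset.mem_coe, Multiset.mem_toFinset, Polynomial.mem_roots hpoly, Polynomial.IsRoot]
    rw [linePoly_eval, h0]
  have hcirc : ∀ t : ℝ, ‖circleMap 0 r t‖ = r := by
    intro t; simp [abs_of_pos hr.1]
  refine ⟨fun x => (2 * Real.pi)⁻¹ • ∫ t in (0 : ℝ)..2 * Real.pi, Ψ (x + circleMap 0 r t • v), ?_, ?_⟩
  · have h1 := analyticAt_param_integral (F := Ψ) (c := fun t => circleMap 0 r t • v)
      ((continuous_circleMap 0 r).smul continuous_const) Real.two_pi_pos.le (p := p) (fun t _ =>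
        hΨ _ (hεO _ (by rw [hcirc]; exact hr.2)) (hsph _ (hcirc t)))
    exact (analyticAt_const (v := (((2 * Real.pi)⁻¹ : ℝ) : ℂ))).mul h1 |>.congr (by
      filter_upwards with x
      simp)
  · have hc2 : Continuous fun z : CE N × ℂ => z.1 + z.2 • v := by fun_prop
    have e1 : ∀ᶠ x in 𝓝 p, ∀ s ∈ Metric.closedBall (0 : ℂ) r, x + s • v ∈ O := by
      refine (isCompact_closedBall (0 : ℂ) r).eventually_forall_of_forall_eventually
        (P := fun x s => x + s • v ∈ O) fun s hs => ?_
      exact (hO.preimage hc2).mem_nhds (hεO s (by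
        rw [mem_closedBall_zero_iff] at hs; exact hs.trans_lt hr.2))
    have e2 : ∀ᶠ x in 𝓝 p, ∀ s ∈ Metric.sphere (0 : ℂ) r, eval (x + s • v) g ≠ 0 := by
      refine (isCompact_sphere (0 : ℂ) r).eventually_forall_of_forall_eventually
        (P := fun x s => eval (x + s • v) g ≠ 0) fun s hs => ?_
      exact ((continuous_eval_mv g).comp hc2).continuousAt.eventually_ne (hsph s (by simpa using hs))
    filter_upwards [e1, e2] with x h1 h2 hx
    have hpx : linePoly x v g ≠ 0 := by
      intro h
      have := linePoly_eval x v g 0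
      rw [h] at this
      simp at this
      exact hx this.symm
    have hcx : Continuous fun s : ℂ => x + s • v := by fun_prop
    have hZ : ∀ s : ℂ, s ∉ ((linePoly x v g).roots.toFinset : Set ℂ) → eval (x + s • v) g ≠ 0 := by
      intro s hs h0
      refine hs ?_
      simp only [Finset.mem_coe, Multiset.mem_toFinset, Polynomial.mem_roots hpx, Polynomial.IsRoot]
      rw [linePoly_eval, h0]
    have hZ' : ∀ s : ℂ, eval (x + s • v) g ≠ 0 → s ∉ ((linePoly x v g).roots.toFinset : Set ℂ) := by
      intro s hs h0
      refine hs ?_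
      simp only [Finset.mem_coe, Multiset.mem_toFinset, Polynomial.mem_roots hpx, Polynomial.IsRoot] at h0
      rwa [linePoly_eval] at h0
    obtain ⟨h, hd, he⟩ := removable_finite (f := fun s => Ψ (x + s • v)) (M := M)
      (linePoly x v g).roots.toFinset (hO.preimage hcx) (by
        intro s hs
        have a1 : DifferentiableAt ℂ Ψ (x + s • v) := (hΨ _ hs.1 (hZ s hs.2)).differentiableAt
        have a2 : DifferentiableAt ℂ (fun s : ℂ => x + s • v) s := by fun_prop
        exact (DifferentiableAt.comp (f := fun s : ℂ => x + s • v) s a1 a2).differentiableWithinAt)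
      (fun s hs => hM _ hs.1 (hZ s hs.2))
    have hcl : DiffContOnCl ℂ h (Metric.ball 0 |r|) := by
      apply DifferentiableOn.diffContOnCl
      rw [abs_of_pos hr.1, closure_ball _ hr.1.ne']
      exact hd.mono fun s hs => h1 s hs
    have hav := hcl.circleAverage
    rw [Real.circleAverage_def] at hav
    have h00 : h 0 = Ψ x := by
      rw [he 0 ⟨by simpa using h1 0 (by simp [hr.1.le]), hZ' 0 (by simpa using hx)⟩]
      simp
    rw [← h00, ← hav]
    congr 1
    refine intervalIntegral.integral_congr fun t _ => ?_
    have hm : circleMap 0 r t ∈ Metric.sphere (0 : ℂ) r := by simpa using hcirc t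
    exact (he _ ⟨h1 _ (Metric.sphere_subset_closedBall hm), hZ' _ (h2 _ hm)⟩).symm
end PartH3

section PartE1
theorem analyticAt_eval_comp {E : Type*} [NormedAddCommGroup E] [NormedSpace ℂ E] {N : ℕ}
    {f : E → Fin N → ℂ} {z : E} (hf : AnalyticAt ℂ f z) (p : MvPolynomial (Fin N) ℂ) :
    AnalyticAt ℂ (fun x => eval (f x) p) z := by
  have := AnalyticAt.aeval_mvPolynomial (A := ℂ) (analyticAt_pi_iff.1 hf) p
  simpa [MvPolynomial.aeval_eq_eval] using this

theorem analyticAt_pev_comp {E : Type*} [NormedAddCommGroup E] [NormedSpace ℂ E] {k : ℕ}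
    {y : E → Fin k → ℂ} {t : E → ℂ} {z : E} (hy : AnalyticAt ℂ y z) (ht : AnalyticAt ℂ t z)
    (P : Polynomial (MvPolynomial (Fin k) ℂ)) :
    AnalyticAt ℂ (fun x => pev (y x) (t x) P) z := by
  induction P using Polynomial.induction_on' with
  | add p q hp hq =>
    simp only [map_add]
    exact hp.add hq
  | monomial n a =>
    have : (fun x => pev (y x) (t x) (Polynomial.monomial n a)) = fun x => eval (y x) a * t x ^ n := by
      ext x; simp [pev]
    rw [this]
    exact (analyticAt_eval_comp hy a).mul (ht.pow n)

theorem pev_eq_eval {k : ℕ} (y : Fin k → ℂ) (t : ℂ) (P : Polynomial (MvPolynomial (Fin k) ℂ)) :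
    pev y t P = (P.map (eval y)).eval t := by
  simp [pev, Polynomial.eval_map]

theorem hasDerivAt_pev {k : ℕ} (y : Fin k → ℂ) (t : ℂ) (P : Polynomial (MvPolynomial (Fin k) ℂ)) :
    HasDerivAt (fun t => pev y t P) (pev y t (Polynomial.derivative P)) t := by
  simp only [pev_eq_eval, ← Polynomial.derivative_map]
  exact Polynomial.hasDerivAt _ _

theorem implicit_root {k : ℕ} (Φ : Polynomial (MvPolynomial (Fin k) ℂ)) (y0 : Fin k → ℂ) (t0 : ℂ)
    (h0 : pev y0 t0 Φ = 0) (h1 : pev y0 t0 (Polynomial.derivative Φ) ≠ 0) :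
    ∃ τ : (Fin k → ℂ) → ℂ, AnalyticAt ℂ τ y0 ∧ τ y0 = t0 ∧
      ∀ᶠ v in 𝓝 (y0, t0), pev v.1 v.2 Φ = 0 ↔ τ v.1 = v.2 := by
  have hf : AnalyticAt ℂ (fun v : (Fin k → ℂ) × ℂ => pev v.1 v.2 Φ) (y0, t0) :=
    analyticAt_pev_comp analyticAt_fst analyticAt_snd Φ
  have hc : ContDiffAt ℂ ⊤ (fun v : (Fin k → ℂ) × ℂ => pev v.1 v.2 Φ) (y0, t0) := hf.contDiffAt
  have hinv : (fderiv ℂ (fun v : (Fin k → ℂ) × ℂ => pev v.1 v.2 Φ) (y0, t0) ∘L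
      .inr ℂ (Fin k → ℂ) ℂ).IsInvertible := by
    refine ⟨ContinuousLinearEquiv.unitsEquivAut ℂ (Units.mk0 _ h1), ?_⟩
    ext
    simp only [ContinuousLinearEquiv.coe_coe, ContinuousLinearEquiv.unitsEquivAut_apply, one_mul,
      Units.val_mk0, ContinuousLinearMap.comp_apply, ContinuousLinearMap.inr_apply]
    have hd := hf.differentiableAt.hasFDerivAt
    have hl : HasDerivAt (fun t : ℂ => (y0, t)) ((0 : Fin k → ℂ), (1 : ℂ)) t0 :=
      (hasDerivAt_const t0 y0).prodMk (hasDerivAt_id t0)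
    have hcomp := HasFDerivAt.comp_hasDerivAt (f := fun t : ℂ => (y0, t)) t0 hd hl
    exact (hasDerivAt_pev y0 t0 Φ).unique hcomp
  refine ⟨hc.implicitFunction (by simp) hinv, ?_, ?_, ?_⟩
  · exact (hc.contDiffAt_implicitFunction (by simp) hinv).analyticAt
  · exact hc.implicitFunction_apply_self (by simp) hinv
  · have := hc.eventually_apply_eq_iff_implicitFunction (by simp) hinv
    simpa [h0] using this

namespace EtPres
variable {N : ℕ} {q : Ideal (MvPolynomial (Fin N) ℂ)} {h : MvPolynomial (Fin N) ℂ} (D : EtPres q h)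

/-- The projection to the parameter space. -/
noncomputable def pr (x : CE N) : CE D.k := fun j => eval x (D.y j)

/-- The étale locus. -/
def W : Set (CE N) := {x | (∀ p ∈ q, eval x p = 0) ∧ eval (D.pr x) D.δ ≠ 0}

theorem continuous_pr : Continuous D.pr := continuous_pi fun j => continuous_eval_mv (D.y j)

theorem analyticAt_pr (x : CE N) : AnalyticAt ℂ D.pr x :=
  analyticAt_pi_iff.2 fun j => analyticAt_eval_comp analyticAt_id (D.y j)

theorem exists_section {x0 : CE N} (hx0 : x0 ∈ D.W) :
    ∃ σ : CE D.k → CE N, AnalyticAt ℂ σ (D.pr x0) ∧ σ (D.pr x0) = x0 ∧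
      (∀ᶠ y in 𝓝 (D.pr x0), σ y ∈ D.W ∧ D.pr (σ y) = y) ∧
      ∀ᶠ x in 𝓝 x0, x ∈ D.W → σ (D.pr x) = x := by
  obtain ⟨τ, hτ, hτ0, hτe⟩ := implicit_root D.Φ (D.pr x0) (eval x0 D.θ) (D.hΦ0 x0 hx0.1)
    (D.hΦ' _ _ hx0.2 (D.hΦ0 x0 hx0.1))
  have hδa : AnalyticAt ℂ (fun y : CE D.k => eval y D.δ) (D.pr x0) :=
    analyticAt_eval_comp analyticAt_id D.δ
  have hδn : ∀ᶠ y in 𝓝 (D.pr x0), eval y D.δ ≠ 0 := hδa.continuousAt.eventually_ne hx0.2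
  refine ⟨fun y i => pev y (τ y) (D.b i) / eval y D.δ, ?_, ?_, ?_, ?_⟩
  · exact analyticAt_pi_iff.2 fun i => (analyticAt_pev_comp analyticAt_id hτ (D.b i)).div hδa hx0.2
  · ext i
    show pev (D.pr x0) (τ (D.pr x0)) (D.b i) / eval (D.pr x0) D.δ = x0 i
    rw [hτ0]
    exact (D.hinv x0 hx0.1 hx0.2 i).symm
  · have hct : Tendsto (fun y => (y, τ y)) (𝓝 (D.pr x0)) (𝓝 (D.pr x0, eval x0 D.θ)) := by
      rw [← hτ0]
      exact (continuousAt_id.prodMk hτ.continuousAt)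
    filter_upwards [hδn, hct.eventually hτe] with y h1 h2
    obtain ⟨a1, a2, a3⟩ := D.hsec y (τ y) h1 (h2.2 rfl) _ (fun i => rfl)
    have a2' : D.pr (fun i => pev y (τ y) (D.b i) / eval y D.δ) = y := funext a2
    exact ⟨⟨a1, by rw [a2']; exact h1⟩, a2'⟩
  · have hct : Tendsto (fun x => (D.pr x, eval x D.θ)) (𝓝 x0) (𝓝 (D.pr x0, eval x0 D.θ)) :=
      (D.continuous_pr.prodMk (continuous_eval_mv D.θ)).tendsto x0
    filter_upwards [hct.eventually hτe] with x h2 hx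
    have h3 := h2.1 (D.hΦ0 x hx.1)
    ext i
    show pev (D.pr x) (τ (D.pr x)) (D.b i) / eval (D.pr x) D.δ = x i
    rw [show τ (D.pr x) = eval x D.θ from h3]
    exact (D.hinv x hx.1 hx.2 i).symm

end EtPres
end PartE1

section PartF1
theorem IsAnalyticSet.mem_of_mem_closure {N : ℕ} {G A : Set (CE N)} (hA : IsAnalyticSet G A)
    {x : CE N} (hx : x ∈ G) (hxA : x ∈ closure A) : x ∈ A := by
  obtain ⟨U, hU, hxU, hUG, s, hs, hsA⟩ := hA.2 x hx
  have : x ∈ A ∩ U := by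
    rw [hsA]
    refine ⟨hxU, fun f hf => ?_⟩
    by_contra hne
    have h1 := ((hs f hf) x hxU).continuousAt.eventually_ne hne
    obtain ⟨x', ⟨h2, h3⟩, h4⟩ := mem_closure_iff_nhds.1 hxA _ (h1.and (hU.mem_nhds hxU))
    have : x' ∈ A ∩ U := ⟨h4, h3⟩
    rw [hsA] at this
    exact h2 (this.2 f hf)
  exact this.1

namespace EtPres
variable {N : ℕ} {q : Ideal (MvPolynomial (Fin N) ℂ)} {h : MvPolynomial (Fin N) ℂ} (D : EtPres q h)

theorem exists_chart {x0 : CE N} (hx0 : x0 ∈ D.W) {O : Set (CE N)} (hO : O ∈ 𝓝 x0) :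
    ∃ (ε : ℝ) (σ : CE D.k → CE N), 0 < ε ∧ AnalyticOnNhd ℂ σ (Metric.ball (D.pr x0) ε) ∧
      (∀ y ∈ Metric.ball (D.pr x0) ε, σ y ∈ D.W ∧ σ y ∈ O ∧ D.pr (σ y) = y) ∧
      σ (D.pr x0) = x0 ∧
      ∀ᶠ x in 𝓝 x0, x ∈ D.W → D.pr x ∈ Metric.ball (D.pr x0) ε ∧ σ (D.pr x) = x := by
  obtain ⟨σ, h1, h2, h3, h4⟩ := D.exists_section hx0
  have h5 : ∀ᶠ y in 𝓝 (D.pr x0), σ y ∈ O := h1.continuousAt.eventually_mem (by rwa [h2])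
  obtain ⟨ε, hε, hb⟩ := Metric.mem_nhds_iff.1 (h1.eventually_analyticAt.and (h3.and h5))
  refine ⟨ε, σ, hε, fun y hy => (hb hy).1, fun y hy => ⟨(hb hy).2.1.1, (hb hy).2.2, (hb hy).2.1.2⟩,
    h2, ?_⟩
  filter_upwards [h4, D.continuous_pr.continuousAt.eventually_mem (Metric.ball_mem_nhds _ hε)]
    with x a1 a2 a3
  exact ⟨a2, a1 a3⟩

/-- Connected components of `W ∩ G` are relatively open in `W`. -/
theorem component_open {G : Set (CE N)} (hG : IsOpen G) {a x0 : CE N}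
    (hx0 : x0 ∈ connectedComponentIn (D.W ∩ G) a) :
    ∀ᶠ x in 𝓝 x0, x ∈ D.W → x ∈ connectedComponentIn (D.W ∩ G) a := by
  have hmem := connectedComponentIn_subset _ _ hx0
  obtain ⟨ε, σ, hε, h1, h2, h3, h4⟩ := D.exists_chart hmem.1 (hG.mem_nhds hmem.2)
  have hconn : IsPreconnected (σ '' Metric.ball (D.pr x0) ε) :=
    (convex_ball _ _).isPreconnected.image _ h1.continuousOn
  have hsub : σ '' Metric.ball (D.pr x0) ε ⊆ connectedComponentIn (D.W ∩ G) x0 :=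
    hconn.subset_connectedComponentIn ⟨_, Metric.mem_ball_self hε, h3⟩ (by
      rintro _ ⟨y, hy, rfl⟩
      exact ⟨(h2 y hy).1, (h2 y hy).2.1⟩)
  rw [← connectedComponentIn_eq hx0] at hsub
  filter_upwards [h4] with x hx hxW
  exact hsub ⟨_, (hx hxW).1, (hx hxW).2⟩

theorem irred_aux {G : Set (CE N)} (hG : IsOpen G) {S : Set (CE N)} (hSW : S ⊆ D.W ∩ G)
    (hSo : ∀ x ∈ S, ∀ᶠ x' in 𝓝 x, x' ∈ D.W → x' ∈ S) (hSp : IsPreconnected S)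
    {A B : Set (CE N)} (hA : IsAnalyticSet G A) (hB : IsAnalyticSet G B) (hAB : S ⊆ A ∪ B) :
    S ⊆ A ∨ S ⊆ B := by
  by_contra hcon
  push Not at hcon
  obtain ⟨hnA, hnB⟩ := hcon
  let u : Set (CE N) := {x | ∀ᶠ x' in 𝓝 x, x' ∈ D.W → x' ∈ A}
  have hu : IsOpen u := isOpen_setOfPred_eventually_nhds
  have huA : ∀ x ∈ S, x ∈ u → x ∈ A := fun x hx hxu => hxu.self_of_nhds (hSW hx).1
  have hclosed : ∀ x ∈ S, x ∈ closure (S ∩ u) → x ∈ u := by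
    intro x hx hxc
    obtain ⟨U, hU, hxU, hUG, s, hs, hsA⟩ := hA.2 x (hSW hx).2
    obtain ⟨ε, σ, hε, h1, h2, h3, h4⟩ := D.exists_chart (hSW hx).1 (hU.mem_nhds hxU)
    obtain ⟨x', h5, hx'S, hx'u⟩ := mem_closure_iff_nhds.1 hxc _ h4
    obtain ⟨hb, hσ⟩ := h5 (hSW hx'S).1
    have hzero : ∀ f ∈ s, ∀ y ∈ Metric.ball (D.pr x) ε, f (σ y) = 0 := by
      intro f hf
      have han : AnalyticOnNhd ℂ (fun y => f (σ y)) (Metric.ball (D.pr x) ε) := fun y hy =>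
        AnalyticAt.fun_comp (hs f hf _ (h2 y hy).2.1) (h1 y hy)
      have hev : (fun y => f (σ y)) =ᶠ[𝓝 (D.pr x')] fun _ => 0 := by
        have hc : Tendsto σ (𝓝 (D.pr x')) (𝓝 x') := by
          have := (h1 _ hb).continuousAt
          unfold ContinuousAt at this
          rwa [hσ] at this
        filter_upwards [hc.eventually hx'u, Metric.isOpen_ball.mem_nhds hb] with y e1 e2
        have : σ y ∈ A ∩ U := ⟨e1 (h2 y e2).1, (h2 y e2).2.1⟩
        rw [hsA] at this
        exact this.2 f hf
      exact fun y hy => han.eqOn_of_preconnected_of_eventuallyEq (g := fun _ => 0)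
        (fun _ _ => analyticAt_const) (convex_ball _ _).isPreconnected hb hev hy
    show ∀ᶠ x' in 𝓝 x, x' ∈ D.W → x' ∈ A
    filter_upwards [h4] with z hz hzW
    obtain ⟨e1, e2⟩ := hz hzW
    have : z ∈ A ∩ U := by
      rw [hsA, ← e2]
      exact ⟨(h2 _ e1).2.1, fun f hf => hzero f hf _ e1⟩
    exact this.1
  by_cases hne : (S ∩ u).Nonempty
  · obtain ⟨x, hx, hxA⟩ := not_subset.1 hnA
    have hxu : x ∉ u := fun e => hxA (huA x hx e)
    obtain ⟨z, hz, hz1, hz2⟩ := hSp u (closure (S ∩ u))ᶜ hu isClosed_closure.isOpen_compl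
      (fun z hz => by
        by_cases hzu : z ∈ u
        · exact Or.inl hzu
        · exact Or.inr fun e => hzu (hclosed z hz e)) hne
      ⟨x, hx, fun e => hxu (hclosed x hx e)⟩
    exact hz2 (subset_closure ⟨hz, hz1⟩)
  · refine hnB fun x hx => hB.mem_of_mem_closure (hSW hx).2 ?_
    have hxu : x ∉ u := fun e => hne ⟨x, hx, e⟩
    rw [mem_closure_iff_frequently]
    have hfr : ∃ᶠ x' in 𝓝 x, ¬ (x' ∈ D.W → x' ∈ A) := not_eventually.1 hxu
    refine (hfr.and_eventually (hSo x hx)).mono fun z hz => ?_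
    push Not at hz
    exact (hAB (hz.2 hz.1.1)).resolve_left hz.1.2

end EtPres
end PartF1

section PartG1
theorem tendsto_eventually_ne {α X : Type*} [TopologicalSpace X] [T2Space X] {l : Filter α}
    {f g : α → X} {a b : X} (hf : Tendsto f l (𝓝 a)) (hg : Tendsto g l (𝓝 b)) (hab : a ≠ b) :
    ∀ᶠ x in l, f x ≠ g x := by
  obtain ⟨u, v, hu, hv, ha, hb, huv⟩ := t2_separation hab
  filter_upwards [hf.eventually (hu.mem_nhds ha), hg.eventually (hv.mem_nhds hb)] with x h1 h2 e
  exact Set.disjoint_left.1 huv h1 (e ▸ h2)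

/-- The linear form `v ↦ ∑ v_i s^i`. -/
noncomputable def ell {N : ℕ} (s : ℕ) (v : CE N) : ℂ := ∑ i, v i * (s : ℂ) ^ (i : ℕ)

theorem ell_zero_card {N : ℕ} {v : CE N} (hv : v ≠ 0) (M : ℕ) :
    ((Finset.range M).filter (fun s => ell s v = 0)).card ≤ N := by
  classical
  obtain ⟨P, hP⟩ : ∃ P : Polynomial ℂ, P = ∑ i : Fin N, Polynomial.C (v i) * Polynomial.X ^ (i : ℕ) :=
    ⟨_, rfl⟩
  have hev : ∀ s : ℕ, P.eval (s : ℂ) = ell s v := by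
    intro s; simp [hP, ell, Polynomial.eval_finsetSum]
  have hco : ∀ i : Fin N, P.coeff i = v i := by
    intro i
    simp only [hP, Polynomial.finsetSum_coeff, Polynomial.coeff_C_mul_X_pow, Fin.val_inj]
    simp
  have hP0 : P ≠ 0 := by
    intro h
    apply hv
    ext i
    rw [← hco i, h]; simp
  have hdeg : P.natDegree ≤ N := by
    rw [hP]
    refine Polynomial.natDegree_sum_le_of_forall_le _ _ fun i _ => ?_
    exact (Polynomial.natDegree_C_mul_X_pow_le _ _).trans i.2.le
  calc _ ≤ P.roots.toFinset.card := by
        refine Finset.card_le_card_of_injOn (fun s : ℕ => (s : ℂ)) ?_ (fun a _ b _ hab =>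
          Nat.cast_injective hab)
        intro s hs
        simp only [Finset.coe_filter, mem_ofPred_eq] at hs
        simp only [Finset.mem_coe, Multiset.mem_toFinset, Polynomial.mem_roots hP0, Polynomial.IsRoot, hev]
        exact hs.2
    _ ≤ _ := (Multiset.toFinset_card_le _).trans ((Polynomial.card_roots' _).trans hdeg)

theorem continuous_ell {N : ℕ} (s : ℕ) : Continuous (ell s : CE N → ℂ) := by
  unfold ell; fun_prop

theorem analyticAt_ell {N : ℕ} (s : ℕ) (v : CE N) : AnalyticAt ℂ (ell s : CE N → ℂ) v := by
  unfold ell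
  refine Finset.analyticAt_fun_sum _ fun i _ => ?_
  exact ((ContinuousLinearMap.proj (R := ℂ) (φ := fun _ : Fin N => ℂ) i).analyticAt v).mul analyticAt_const

theorem ell_bound {N : ℕ} {K : Set (CE N)} (hK : IsCompact K) (h0 : (0 : CE N) ∉ K) (M : ℕ) :
    ∃ c : ℝ, 0 < c ∧ ∀ v ∈ K, ((Finset.range M).filter (fun s => ‖ell s v‖ < c)).card ≤ N := by
  classical
  refine hK.induction_on (p := fun K => ∃ c : ℝ, 0 < c ∧ ∀ v ∈ K,
    ((Finset.range M).filter (fun s => ‖ell s v‖ < c)).card ≤ N) ?_ ?_ ?_ ?_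
  · exact ⟨1, one_pos, by simp⟩
  · rintro s t hst ⟨c, hc, h⟩
    exact ⟨c, hc, fun v hv => h v (hst hv)⟩
  · rintro s t ⟨c, hc, h⟩ ⟨c', hc', h'⟩
    refine ⟨min c c', lt_min hc hc', ?_⟩
    rintro v (hv | hv)
    · exact (Finset.card_le_card (Finset.monotone_filter_right _ fun s _ hs =>
        lt_of_lt_of_le hs (min_le_left _ _))).trans (h v hv)
    · exact (Finset.card_le_card (Finset.monotone_filter_right _ fun s _ hs =>
        lt_of_lt_of_le hs (min_le_right _ _))).trans (h' v hv)
  · intro v hv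
    have hv0 : v ≠ 0 := fun e => h0 (e ▸ hv)
    obtain ⟨c, hc, hc1⟩ : ∃ c : ℝ, 0 < c ∧ ∀ s ∈ Finset.range M, ell s v ≠ 0 → c < ‖ell s v‖ := by
      have : ∀ᶠ c in 𝓝[>] (0 : ℝ), ∀ s ∈ Finset.range M, ell s v ≠ 0 → c < ‖ell s v‖ := by
        rw [eventually_all_finset]
        intro s _
        by_cases hs : ell s v = 0
        · simp [hs]
        · filter_upwards [Ioo_mem_nhdsGT (norm_pos_iff.2 hs)] with c hc _
          exact hc.2
      obtain ⟨c, hc, h⟩ := (this.and self_mem_nhdsWithin).exists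
      exact ⟨c, h, hc⟩
    have hev : ∀ᶠ v' in 𝓝 v, ∀ s ∈ Finset.range M, ell s v ≠ 0 → c < ‖ell s v'‖ := by
      rw [eventually_all_finset]
      intro s hs
      by_cases hs0 : ell s v = 0
      · simp [hs0]
      · filter_upwards [((continuous_ell s).norm.continuousAt (x := v)).eventually_const_lt (hc1 s hs hs0)]
          with v' hv' _
        exact hv'
    refine ⟨_, nhdsWithin_le_nhds hev, c, hc, fun v' hv' => ?_⟩
    refine (Finset.card_le_card ?_).trans (ell_zero_card hv0 M)
    intro s hs
    rw [Finset.mem_filter] at hs ⊢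
    refine ⟨hs.1, ?_⟩
    by_contra hne
    exact absurd (hv' s hs.1 hne) (not_lt.2 hs.2.le)

theorem dense_eval_ne_zero {N : ℕ} {g : MvPolynomial (Fin N) ℂ} (hg : g ≠ 0) (w : CE N) :
    ∃ᶠ z in 𝓝 w, eval z g ≠ 0 := by
  obtain ⟨x1, hx1⟩ := exists_eval_ne_zero hg
  have hpoly : linePoly w (x1 - w) g ≠ 0 := by
    intro h
    have := linePoly_eval w (x1 - w) g 1
    rw [h] at this
    simp at this
    exact hx1 this.symm
  have h1 : ∀ᶠ s in 𝓝[≠] (0 : ℂ), eval (w + s • (x1 - w)) g ≠ 0 := by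
    have hfin : ((linePoly w (x1 - w) g).roots.toFinset : Set ℂ).Finite := Finset.finite_toSet _
    have : ∀ᶠ s in 𝓝[≠] (0 : ℂ), s ∉ ((linePoly w (x1 - w) g).roots.toFinset : Set ℂ) := by
      have h2 := (hfin.subset (sdiff_subset (t := {0}))).isClosed.isOpen_compl.mem_nhds
        (show (0 : ℂ) ∉ ((linePoly w (x1 - w) g).roots.toFinset : Set ℂ) \ {0} by simp)
      filter_upwards [nhdsWithin_le_nhds h2, self_mem_nhdsWithin] with s hs hs0 hs1
      exact hs ⟨hs1, hs0⟩
    filter_upwards [this] with s hs h0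
    refine hs ?_
    simp only [Finset.mem_coe, Multiset.mem_toFinset, Polynomial.mem_roots hpoly, Polynomial.IsRoot]
    rw [linePoly_eval, h0]
  have hc : Tendsto (fun s : ℂ => w + s • (x1 - w)) (𝓝[≠] 0) (𝓝 w) := by
    have : Continuous fun s : ℂ => w + s • (x1 - w) := by fun_prop
    have h2 := this.tendsto 0
    simp only [zero_smul, add_zero] at h2
    exact h2.mono_left nhdsWithin_le_nhds
  exact hc.frequently h1.frequently

namespace EtPres
variable {N : ℕ} {q : Ideal (MvPolynomial (Fin N) ℂ)} {h : MvPolynomial (Fin N) ℂ} (D : EtPres q h)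

theorem fiber_card : ∃ d : ℕ, ∀ y0 : CE D.k, ∃ F : Finset (CE N), F.card ≤ d ∧
    ∀ x : CE N, (∀ p ∈ q, eval x p = 0) → D.pr x = y0 → x ∈ F := by
  classical
  refine ⟨∏ i, (D.Ψ i).natDegree, fun y0 => ⟨Fintype.piFinset fun i =>
    ((D.Ψ i).map (eval y0)).roots.toFinset, ?_, ?_⟩⟩
  · rw [Fintype.card_piFinset]
    refine Finset.prod_le_prod' fun i _ => ?_
    exact (Multiset.toFinset_card_le _).trans ((Polynomial.card_roots' _).trans
      Polynomial.natDegree_map_le)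
  · intro x hx hy
    rw [Fintype.mem_piFinset]
    intro i
    have hm : ((D.Ψ i).map (eval y0)) ≠ 0 := ((D.hΨ i).map _).ne_zero
    rw [Multiset.mem_toFinset, Polynomial.mem_roots hm, Polynomial.IsRoot, ← pev_eq_eval, ← hy]
    exact D.hΨ0 x hx i

theorem isClosed_V : IsClosed {x : CE N | ∀ p ∈ q, eval x p = 0} := by
  have : {x : CE N | ∀ p ∈ q, eval x p = 0} = ⋂ p ∈ q, {x : CE N | eval x p = 0} := by
    ext x; simp
  rw [this]
  exact isClosed_biInter fun p _ => isClosed_eq (continuous_eval_mv p) continuous_const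

theorem trivialize {G S : Set (CE N)} (hSW : S ⊆ D.W ∩ G)
    (hSo : ∀ x ∈ S, ∀ᶠ x' in 𝓝 x, x' ∈ D.W → x' ∈ S)
    (hSc : ∀ x ∈ D.W ∩ G, x ∈ closure S → x ∈ S)
    {p : CE N} {r ε : ℝ} (hr : Metric.closedBall p r ⊆ G)
    (hsph : ∀ x : CE N, (∀ f ∈ q, eval x f = 0) → dist x p = r → D.pr x ∉ Metric.ball (D.pr p) ε)
    {T : Set (CE N)} (hT : T = S ∩ (Metric.ball p r ∩ D.pr ⁻¹' Metric.ball (D.pr p) ε))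
    {y0 : CE D.k} (hy0 : y0 ∈ Metric.ball (D.pr p) ε) (hδ : eval y0 D.δ ≠ 0) :
    ∃ (F : Finset (CE N)) (σ : CE N → CE D.k → CE N), (∀ x ∈ F, AnalyticAt ℂ (σ x) y0) ∧
      ∀ᶠ y in 𝓝 y0, {x | x ∈ T ∧ D.pr x = y} = (fun x => σ x y) '' F ∧
        InjOn (fun x => σ x y) (F : Set (CE N)) := by
  classical
  have hU0 : IsOpen (Metric.ball p r ∩ D.pr ⁻¹' Metric.ball (D.pr p) ε) :=
    Metric.isOpen_ball.inter (Metric.isOpen_ball.preimage D.continuous_pr)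
  have hTo : ∀ x ∈ T, ∀ᶠ x' in 𝓝 x, x' ∈ D.W → x' ∈ T := by
    intro x hx
    rw [hT] at hx
    filter_upwards [hSo x hx.1, hU0.mem_nhds hx.2] with x' h1 h2 h3
    rw [hT]
    exact ⟨h1 h3, h2⟩
  have hTW : ∀ x ∈ T, x ∈ D.W := by
    intro x hx; rw [hT] at hx; exact (hSW hx.1).1
  obtain ⟨d, hd⟩ := D.fiber_card
  have hfin : {x | x ∈ T ∧ D.pr x = y0}.Finite := by
    obtain ⟨F, _, hF⟩ := hd y0
    exact F.finite_toSet.subset fun x hx => hF x (hTW x hx.1).1 hx.2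
  choose! σ hσ using fun x (hx : x ∈ D.W) => D.exists_section hx
  have hFm : ∀ x, x ∈ hfin.toFinset ↔ x ∈ T ∧ D.pr x = y0 := fun x => by simp
  refine ⟨hfin.toFinset, σ, ?_, ?_⟩
  · intro x hx
    rw [hFm] at hx
    have := (hσ x (hTW x hx.1)).1
    rwa [hx.2] at this
  have hct : ∀ x ∈ hfin.toFinset, Tendsto (σ x) (𝓝 y0) (𝓝 x) := by
    intro x hx
    rw [hFm] at hx
    have h1 := (hσ x (hTW x hx.1)).1.continuousAt
    unfold ContinuousAt at h1
    rwa [(hσ x (hTW x hx.1)).2.1, hx.2] at h1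
  have ea : ∀ᶠ y in 𝓝 y0, ∀ x ∈ hfin.toFinset, σ x y ∈ T ∧ D.pr (σ x y) = y := by
    rw [eventually_all_finset]
    intro x hx
    have h1 := (hct x hx).eventually (hTo x ((hFm x).1 hx).1)
    have h2 := (hσ x (hTW x ((hFm x).1 hx).1)).2.2.1
    rw [((hFm x).1 hx).2] at h2
    filter_upwards [h1, h2] with y a1 a2
    exact ⟨a1 a2.1, a2.2⟩
  have eb : ∀ᶠ y in 𝓝 y0, ∀ x ∈ hfin.toFinset, ∀ x' ∈ hfin.toFinset, x ≠ x' → σ x y ≠ σ x' y := by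
    rw [eventually_all_finset]
    intro x hx
    rw [eventually_all_finset]
    intro x' hx'
    by_cases hne : x = x'
    · simp [hne]
    · have := tendsto_eventually_ne (hct x hx) (hct x' hx') hne
      filter_upwards [this] with y hy _
      exact hy
  have ec : ∀ᶠ y in 𝓝 y0, ∀ x ∈ Metric.closedBall p r, x ∈ T → D.pr x = y →
      ∃ x' ∈ hfin.toFinset, σ x' y = x := by
    refine (isCompact_closedBall p r).eventually_forall_of_forall_eventually
      (P := fun y x => x ∈ T → D.pr x = y → ∃ x' ∈ hfin.toFinset, σ x' y = x) fun x hx => ?_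
    have t1 : Tendsto (fun z : CE D.k × CE N => z.1) (𝓝 (y0, x)) (𝓝 y0) := continuous_fst.tendsto _
    have t2 : Tendsto (fun z : CE D.k × CE N => z.2) (𝓝 (y0, x)) (𝓝 x) := continuous_snd.tendsto _
    by_cases hxy : D.pr x = y0
    swap
    · have := tendsto_eventually_ne ((D.continuous_pr.tendsto x).comp t2) t1 hxy
      filter_upwards [this] with z h1 h2 h3
      exact absurd h3 h1
    by_cases hxT : x ∈ closure T
    swap
    · have := t2.eventually (isClosed_closure.isOpen_compl.mem_nhds hxT)
      filter_upwards [this] with z h1 h2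
      exact absurd (subset_closure h2) h1
    have hxV : ∀ f ∈ q, eval x f = 0 :=
      closure_minimal (fun z hz => (hTW z hz).1) isClosed_V hxT
    have hxW : x ∈ D.W := ⟨hxV, by rw [hxy]; exact hδ⟩
    have hxS : x ∈ S := hSc x ⟨hxW, hr hx⟩ (closure_mono (by rw [hT]; exact inter_subset_left) hxT)
    have hxr : dist x p ≠ r := fun e => hsph x hxV e (by rw [hxy]; exact hy0)
    have hxT' : x ∈ T := by
      rw [hT]
      exact ⟨hxS, lt_of_le_of_ne hx hxr, by rw [mem_preimage, hxy]; exact hy0⟩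
    have := t2.eventually (hσ x hxW).2.2.2
    filter_upwards [this] with z h1 h2 h3
    refine ⟨x, (hFm x).2 ⟨hxT', hxy⟩, ?_⟩
    rw [← h3]
    exact h1 (hTW _ h2)
  filter_upwards [ea, eb, ec] with y ha hb hc
  refine ⟨?_, fun x hx x' hx' e => ?_⟩
  · ext x
    constructor
    · rintro ⟨h1, h2⟩
      obtain ⟨x', hx', e⟩ := hc x (by
        rw [hT] at h1; exact Metric.ball_subset_closedBall h1.2.1) h1 h2
      exact ⟨x', hx', e⟩
    · rintro ⟨x', hx', rfl⟩
      exact ha x' hx'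
  · by_contra hne
    exact hb x hx x' hx' hne e

end EtPres
end PartG1

section PartG2
theorem norm_ell_le {N : ℕ} (s : ℕ) (v : CE N) : ‖ell s v‖ ≤ (∑ i : Fin N, (s : ℝ) ^ (i : ℕ)) * ‖v‖ := by
  unfold ell
  refine (norm_sum_le _ _).trans ?_
  rw [Finset.sum_mul]
  refine Finset.sum_le_sum fun i _ => ?_
  rw [norm_mul, norm_pow, Complex.norm_natCast, mul_comm]
  gcongr
  exact norm_le_pi_norm v i

namespace EtPres
variable {N : ℕ} {q : Ideal (MvPolynomial (Fin N) ℂ)} {h : MvPolynomial (Fin N) ℂ} (D : EtPres q h)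

theorem eval_bind (z : CE N) : eval z (bind₁ D.y D.δ) = eval (D.pr z) D.δ := by
  have h1 := MvPolynomial.aeval_bind₁ (S := ℂ) z D.y D.δ
  simp only [MvPolynomial.aeval_eq_eval] at h1
  exact h1

theorem bind_ne_zero : bind₁ D.y D.δ ≠ 0 := fun e => D.hδ (by rw [e]; exact q.zero_mem)

theorem exists_radius {G : Set (CE N)} (hG : IsOpen G) {p : CE N} (hp : p ∈ G) :
    ∃ r ε : ℝ, 0 < r ∧ 0 < ε ∧ Metric.closedBall p r ⊆ G ∧
      ∀ x : CE N, (∀ f ∈ q, eval x f = 0) → dist x p = r → D.pr x ∉ Metric.ball (D.pr p) ε := by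
  obtain ⟨r0, hr0, hb⟩ := Metric.nhds_basis_closedBall.mem_iff.1 (hG.mem_nhds hp)
  obtain ⟨d, hd⟩ := D.fiber_card
  obtain ⟨F, _, hF⟩ := hd (D.pr p)
  obtain ⟨r, hr, hrF⟩ := (Ioo_infinite hr0).exists_notMem_finite (F.finite_toSet.image fun x => dist x p)
  have hcomp : IsCompact (D.pr '' ({x : CE N | ∀ p ∈ q, eval x p = 0} ∩ Metric.sphere p r)) :=
    ((isCompact_sphere p r).inter_left isClosed_V).image D.continuous_pr
  have hnot : D.pr p ∈ (D.pr '' ({x : CE N | ∀ p ∈ q, eval x p = 0} ∩ Metric.sphere p r))ᶜ := by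
    rintro ⟨x, ⟨hx1, hx2⟩, hx3⟩
    exact hrF ⟨x, hF x hx1 hx3, hx2⟩
  obtain ⟨ε, hε, hεb⟩ := Metric.isOpen_iff.1 hcomp.isClosed.isOpen_compl _ hnot
  refine ⟨r, ε, hr.1, hε, (Metric.closedBall_subset_closedBall hr.2.le).trans hb, ?_⟩
  intro x hx1 hx2 hx3
  exact hεb hx3 ⟨x, ⟨hx1, hx2⟩, rfl⟩

theorem closure_analytic {G : Set (CE N)} (hG : IsOpen G) {S : Set (CE N)} (hSW : S ⊆ D.W ∩ G)
    (hSo : ∀ x ∈ S, ∀ᶠ x' in 𝓝 x, x' ∈ D.W → x' ∈ S)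
    (hSc : ∀ x ∈ D.W ∩ G, x ∈ closure S → x ∈ S) :
    IsAnalyticSet G (closure S ∩ G) := by
  classical
  refine ⟨inter_subset_right, fun p hp => ?_⟩
  obtain ⟨r, ε, hr, hε, hrG, hsph⟩ := D.exists_radius hG hp
  obtain ⟨d, hd⟩ := D.fiber_card
  obtain ⟨U0, hU0d⟩ : ∃ U0, U0 = Metric.ball p r ∩ D.pr ⁻¹' Metric.ball (D.pr p) ε := ⟨_, rfl⟩
  have hU0 : IsOpen U0 := by
    rw [hU0d]; exact Metric.isOpen_ball.inter (Metric.isOpen_ball.preimage D.continuous_pr)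
  have hpU0 : p ∈ U0 := by
    rw [hU0d]; exact ⟨Metric.mem_ball_self hr, Metric.mem_ball_self hε⟩
  obtain ⟨T, hT⟩ : ∃ T, T = S ∩ U0 := ⟨_, rfl⟩
  have hTW : ∀ x ∈ T, x ∈ D.W := by
    intro x hx; rw [hT] at hx; exact (hSW hx.1).1
  have hTr : ∀ x ∈ T, dist x p < r := by
    intro x hx; rw [hT, hU0d] at hx; exact hx.2.1
  have hfin : ∀ y0, ∃ F : Finset (CE N), F.card ≤ d ∧ (F : Set (CE N)) = {x | x ∈ T ∧ D.pr x = y0} := by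
    intro y0
    obtain ⟨F, hFc, hF⟩ := hd y0
    have hf : {x | x ∈ T ∧ D.pr x = y0}.Finite :=
      F.finite_toSet.subset fun x hx => hF x (hTW x hx.1).1 hx.2
    refine ⟨hf.toFinset, (Finset.card_le_card ?_).trans hFc, hf.coe_toFinset⟩
    intro x hx
    rw [hf.mem_toFinset] at hx
    exact hF x (hTW x hx.1).1 hx.2
  choose F hFd hFT using hfin
  obtain ⟨Ψ, hΨ⟩ : ∃ Ψ : ℕ → CE N → ℂ, Ψ = fun s z => ∏ x ∈ F (D.pr z), ell s (z - x) := ⟨_, rfl⟩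
  -- analyticity
  have han : ∀ s, ∀ z ∈ U0, eval z (bind₁ D.y D.δ) ≠ 0 → AnalyticAt ℂ (Ψ s) z := by
    intro s z hz hδ
    rw [D.eval_bind] at hδ
    obtain ⟨F', σ, h1, h2⟩ := D.trivialize hSW hSo hSc hrG hsph (hU0d ▸ hT)
      (show D.pr z ∈ Metric.ball (D.pr p) ε by rw [hU0d] at hz; exact hz.2) hδ
    have hA : AnalyticAt ℂ (fun z => ∏ x ∈ F', ell s (z - σ x (D.pr z))) z := by
      refine Finset.analyticAt_fun_prod _ fun x hx => ?_
      refine AnalyticAt.fun_comp (analyticAt_ell s _) ?_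
      exact analyticAt_id.sub (AnalyticAt.fun_comp (h1 x hx) (D.analyticAt_pr z))
    refine hA.congr ?_
    filter_upwards [(D.continuous_pr.tendsto z).eventually h2] with w hw
    rw [hΨ]
    simp only
    have : F (D.pr w) = F'.image (fun x => σ x (D.pr w)) := by
      rw [← Finset.coe_inj, hFT, hw.1, Finset.coe_image]
    rw [this, Finset.prod_image hw.2]
  -- boundedness
  have hbd : ∀ s, ∃ M : ℝ, ∀ z ∈ U0, eval z (bind₁ D.y D.δ) ≠ 0 → ‖Ψ s z‖ ≤ M := by
    intro s
    obtain ⟨C, hC1, hC⟩ : ∃ C : ℝ, 1 ≤ C ∧ (∑ i : Fin N, (s : ℝ) ^ (i : ℕ)) * (2 * r) ≤ C :=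
      ⟨max 1 _, le_max_left _ _, le_max_right _ _⟩
    refine ⟨C ^ d, fun z hz _ => ?_⟩
    rw [hΨ]
    simp only
    rw [norm_prod]
    calc _ ≤ ∏ x ∈ F (D.pr z), C := by
          refine Finset.prod_le_prod (fun _ _ => norm_nonneg _) fun x hx => ?_
          have hx' : x ∈ T := by
            have : x ∈ (F (D.pr z) : Set (CE N)) := hx
            rw [hFT] at this; exact this.1
          refine (norm_ell_le s _).trans (le_trans ?_ hC)
          gcongr
          rw [← dist_eq_norm]
          have h1 : dist z p < r := by rw [hU0d] at hz; exact hz.1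
          have h2 := hTr x hx'
          have h3 := dist_triangle_right z x p
          linarith
      _ ≤ C ^ d := by
          rw [Finset.prod_const]
          exact pow_le_pow_right₀ hC1 (hFd _)
  have hext : ∀ s, ∃ H : CE N → ℂ, AnalyticAt ℂ H p ∧
      ∀ᶠ x in 𝓝 p, eval x (bind₁ D.y D.δ) ≠ 0 → H x = Ψ s x := by
    intro s
    obtain ⟨M, hM⟩ := hbd s
    exact riemann_ext D.bind_ne_zero hU0 (han s) hM hpU0
  choose H hHa hHe using hext
  have hev : ∀ᶠ x in 𝓝 p, x ∈ U0 ∧ ∀ s ∈ Finset.range (d * N + 1), AnalyticAt ℂ (H s) x ∧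
      (eval x (bind₁ D.y D.δ) ≠ 0 → H s x = Ψ s x) := by
    refine Filter.Eventually.and (hU0.eventually_mem hpU0) ((eventually_all_finset _).2 fun s _ => ?_)
    exact (hHa s).eventually_analyticAt.and (hHe s)
  obtain ⟨U, hUsub, hU, hpU⟩ := _root_.mem_nhds_iff.1 hev
  refine ⟨U, hU, hpU, fun x hx => hrG ?_, (Finset.range (d * N + 1)).image H, ?_, ?_⟩
  · have := (hUsub hx).1
    rw [hU0d] at this
    exact Metric.ball_subset_closedBall this.1
  · intro f hf x hx
    obtain ⟨s, hs, rfl⟩ := Finset.mem_image.1 hf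
    exact ((hUsub hx).2 s hs).1
  have hUG : U ⊆ G := fun x hx => hrG (by
    have := (hUsub hx).1
    rw [hU0d] at this
    exact Metric.ball_subset_closedBall this.1)
  ext w
  constructor
  · rintro ⟨⟨hwS, hwG⟩, hwU⟩
    refine ⟨hwU, fun f hf => ?_⟩
    obtain ⟨s, hs, rfl⟩ := Finset.mem_image.1 hf
    by_contra hne
    have h1 := ((hUsub hwU).2 s hs).1.continuousAt.eventually_ne hne
    obtain ⟨x, ⟨h2, h3⟩, h4⟩ := mem_closure_iff_nhds.1 hwS _ (h1.and (hU.mem_nhds hwU))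
    have hxδ : eval x (bind₁ D.y D.δ) ≠ 0 := by rw [D.eval_bind]; exact (hSW h4).1.2
    apply h2
    rw [((hUsub h3).2 s hs).2 hxδ, hΨ]
    simp only
    refine Finset.prod_eq_zero (i := x) ?_ (by simp [ell])
    rw [← Finset.mem_coe, hFT]
    exact ⟨by rw [hT]; exact ⟨h4, (hUsub h3).1⟩, rfl⟩
  · rintro ⟨hwU, hw⟩
    refine ⟨⟨?_, hUG hwU⟩, hwU⟩
    by_contra hwS
    obtain ⟨η, hη, hηb⟩ := Metric.isOpen_iff.1 isClosed_closure.isOpen_compl w hwS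
    obtain ⟨c, hc, hcK⟩ := ell_bound (N := N)
      (K := Metric.closedBall 0 (2 * r) ∩ (Metric.ball 0 (η / 2))ᶜ)
      ((isCompact_closedBall _ _).inter_right Metric.isOpen_ball.isClosed_compl)
      (fun e => e.2 (Metric.mem_ball_self (half_pos hη))) (d * N + 1)
    obtain ⟨c', hc', hc'1, hc'c⟩ : ∃ c' : ℝ, 0 < c' ∧ c' ≤ 1 ∧ c' ≤ c :=
      ⟨min 1 c, lt_min one_pos hc, min_le_left _ _, min_le_right _ _⟩
    have hlow : ∀ z ∈ U, z ∈ Metric.ball w (η / 2) → eval z (bind₁ D.y D.δ) ≠ 0 →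
        ∃ s ∈ Finset.range (d * N + 1), c' ^ d ≤ ‖H s z‖ := by
      intro z hzU hzb hzδ
      have hxK : ∀ x ∈ F (D.pr z), z - x ∈ Metric.closedBall 0 (2 * r) ∩ (Metric.ball (0 : CE N) (η / 2))ᶜ := by
        intro x hx
        have hx' : x ∈ T := by
          have : x ∈ (F (D.pr z) : Set (CE N)) := hx
          rw [hFT] at this; exact this.1
        have hz0 := (hUsub hzU).1
        rw [hU0d] at hz0
        constructor
        · rw [mem_closedBall_zero_iff, ← dist_eq_norm]
          have h1 : dist z p < r := hz0.1
          have h2 := hTr x hx'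
          have h3 := dist_triangle_right z x p
          linarith
        · intro e
          rw [mem_ball_zero_iff, ← dist_eq_norm] at e
          rw [Metric.mem_ball] at hzb
          refine hηb (show x ∈ Metric.ball w η from ?_) (subset_closure ?_)
          · rw [Metric.mem_ball]
            have := dist_triangle_left x w z
            linarith
          · rw [hT] at hx'; exact hx'.1
      obtain ⟨s, hs, hsb⟩ : ∃ s ∈ Finset.range (d * N + 1), ∀ x ∈ F (D.pr z), c ≤ ‖ell s (z - x)‖ := by
        by_contra! hcon
        have hsub : Finset.range (d * N + 1) ⊆ (F (D.pr z)).biUnion fun x =>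
            (Finset.range (d * N + 1)).filter (fun s => ‖ell s (z - x)‖ < c) := by
          intro s hs
          obtain ⟨x, hx, hlt⟩ := hcon s hs
          exact Finset.mem_biUnion.2 ⟨x, hx, Finset.mem_filter.2 ⟨hs, hlt⟩⟩
        have h1 := Finset.card_le_card hsub
        have h2 := Finset.card_biUnion_le_card_mul (F (D.pr z)) (fun x =>
            (Finset.range (d * N + 1)).filter (fun s => ‖ell s (z - x)‖ < c)) N
            (fun x hx => hcK _ (hxK x hx))
        have h3 : (F (D.pr z)).card * N ≤ d * N := Nat.mul_le_mul_right _ (hFd _)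
        rw [Finset.card_range] at h1
        omega
      refine ⟨s, hs, ?_⟩
      rw [((hUsub hzU).2 s hs).2 hzδ, hΨ]
      simp only
      rw [norm_prod]
      calc c' ^ d ≤ c' ^ (F (D.pr z)).card := pow_le_pow_of_le_one hc'.le hc'1 (hFd _)
        _ = ∏ x ∈ F (D.pr z), c' := by rw [Finset.prod_const]
        _ ≤ _ := Finset.prod_le_prod (fun _ _ => hc'.le) fun x hx => hc'c.trans (hsb x hx)
    have hsmall : ∀ᶠ z in 𝓝 w, ∀ s ∈ Finset.range (d * N + 1), ‖H s z‖ < c' ^ d := by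
      refine (eventually_all_finset _).2 fun s hs => ?_
      have h1 := ((hUsub hwU).2 s hs).1.continuousAt.norm
      refine h1.eventually_lt_const ?_
      show ‖H s w‖ < _
      rw [hw (H s) (Finset.mem_image_of_mem _ hs), norm_zero]
      positivity
    obtain ⟨z, hz1, hz2, hz3, hz4⟩ := ((dense_eval_ne_zero D.bind_ne_zero w).and_eventually
      (hsmall.and ((hU.eventually_mem hwU).and
        (Metric.isOpen_ball.eventually_mem (Metric.mem_ball_self (half_pos hη)))))).exists
    obtain ⟨s, hs, hle⟩ := hlow z hz3 hz4 hz1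
    exact absurd (hz2 s hs) (not_lt.2 hle)

end EtPres
end PartG2

section PartD1
theorem poly_split {S : Type*} [CommRing S] (I : Ideal S) (p : Polynomial S)
    (hp : ∃ n, p.coeff n ∉ I) : ∃ (r : ℕ) (p2 : Polynomial S),
      (∀ n, (p - Polynomial.X ^ r * p2).coeff n ∈ I) ∧ p2.coeff 0 ∉ I := by
  classical
  obtain ⟨r, hr, hmin⟩ : ∃ r, p.coeff r ∉ I ∧ ∀ j < r, p.coeff j ∈ I :=
    ⟨Nat.find hp, Nat.find_spec hp, fun j hj => not_not.1 (Nat.find_min hp hj)⟩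
  have hc : ∀ j, (∑ j ∈ Finset.range (p.natDegree + 1), Polynomial.monomial j (p.coeff (j + r))).coeff j
      = p.coeff (j + r) := by
    intro j
    rw [Polynomial.finsetSum_coeff]
    simp only [Polynomial.coeff_monomial]
    rw [Finset.sum_ite_eq' (Finset.range (p.natDegree + 1)) j]
    split_ifs with h
    · rfl
    · rw [Polynomial.coeff_eq_zero_of_natDegree_lt]
      simp at h; omega
  refine ⟨r, ∑ j ∈ Finset.range (p.natDegree + 1), Polynomial.monomial j (p.coeff (j + r)), ?_, ?_⟩
  · intro n
    rw [Polynomial.coeff_sub, Polynomial.coeff_X_pow_mul']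
    split_ifs with h
    · rw [hc, Nat.sub_add_cancel h, sub_self]; exact I.zero_mem
    · simpa using hmin n (not_le.1 h)
  · rw [hc, zero_add]; exact hr

/-- evaluation of a doubly nested polynomial -/
noncomputable def pev2 {N : ℕ} (x : CE N) (t s : ℂ) (P : Polynomial (Polynomial (MvPolynomial (Fin N) ℂ))) : ℂ :=
  Polynomial.eval₂ (Polynomial.eval₂RingHom (eval x) t) s P

noncomputable def spread {N : ℕ} (v : CE N) (P : MvPolynomial (Fin (N + 1)) ℂ) :
    Polynomial (Polynomial (MvPolynomial (Fin N) ℂ)) :=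
  MvPolynomial.eval₂ (Polynomial.C.comp (Polynomial.C.comp MvPolynomial.C))
    (Fin.snoc (α := fun _ => Polynomial (Polynomial (MvPolynomial (Fin N) ℂ)))
     (fun i => Polynomial.C (Polynomial.C (X i)) +
      Polynomial.X * Polynomial.C (Polynomial.C (C (v i)))) (Polynomial.C Polynomial.X)) P

theorem pev2_spread {N : ℕ} (x v : CE N) (t s : ℂ) (P : MvPolynomial (Fin (N + 1)) ℂ) :
    pev2 x t s (spread v P) = eval (Fin.snoc (α := fun _ => ℂ) (x + s • v) t) P := by
  have : (Polynomial.eval₂RingHom (Polynomial.eval₂RingHom (eval x) t) s).comp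
      (MvPolynomial.eval₂Hom (Polynomial.C.comp (Polynomial.C.comp MvPolynomial.C))
    (Fin.snoc (α := fun _ => Polynomial (Polynomial (MvPolynomial (Fin N) ℂ)))
     (fun i => Polynomial.C (Polynomial.C (X i)) +
      Polynomial.X * Polynomial.C (Polynomial.C (C (v i)))) (Polynomial.C Polynomial.X)))
      = eval (Fin.snoc (α := fun _ => ℂ) (x + s • v) t) := by
    apply MvPolynomial.ringHom_ext
    · intro r; simp
    · intro i
      refine Fin.lastCases ?_ (fun i => ?_) i
      · simp
      · simp [mul_comm]
  exact congrArg (fun φ : MvPolynomial (Fin (N + 1)) ℂ →+* ℂ => φ P) this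

theorem pev_eq_zero_of_coeff {N : ℕ} {q : Ideal (MvPolynomial (Fin N) ℂ)} {x : CE N}
    (hx : ∀ p ∈ q, eval x p = 0) (t : ℂ) (P : Polynomial (MvPolynomial (Fin N) ℂ))
    (hP : ∀ n, P.coeff n ∈ q) : Polynomial.eval₂ (eval x) t P = 0 := by
  rw [Polynomial.eval₂_eq_sum_range]
  exact Finset.sum_eq_zero fun i _ => by rw [hx _ (hP i), zero_mul]

theorem pev2_eq_zero_of_coeff {N : ℕ} {q : Ideal (MvPolynomial (Fin N) ℂ)} {x : CE N}
    (hx : ∀ p ∈ q, eval x p = 0) (t s : ℂ) (P : Polynomial (Polynomial (MvPolynomial (Fin N) ℂ)))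
    (hP : ∀ n, P.coeff n ∈ q.map Polynomial.C) : pev2 x t s P = 0 := by
  unfold pev2
  rw [Polynomial.eval₂_eq_sum_range]
  refine Finset.sum_eq_zero fun i _ => ?_
  have := pev_eq_zero_of_coeff hx t _ (Ideal.mem_map_C_iff.1 (hP i))
  rw [Polynomial.coe_eval₂RingHom, this, zero_mul]

theorem continuous_ev {N : ℕ} (P : Polynomial (MvPolynomial (Fin N) ℂ)) :
    Continuous fun u : CE N × ℂ => Polynomial.eval₂ (eval u.1) u.2 P := by
  simp only [Polynomial.eval₂_eq_sum_range]
  refine continuous_finsetSum _ fun i _ => ?_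
  exact ((continuous_eval_mv _).comp continuous_fst).mul (continuous_snd.pow _)

theorem continuous_ev2 {N : ℕ} (P : Polynomial (Polynomial (MvPolynomial (Fin N) ℂ))) :
    Continuous fun u : CE N × ℂ × ℂ => pev2 u.1 u.2.1 u.2.2 P := by
  simp only [pev2, Polynomial.eval₂_eq_sum_range]
  refine continuous_finsetSum _ fun i _ => ?_
  exact ((continuous_ev (P.coeff i)).comp
    (continuous_fst.prodMk (continuous_fst.comp continuous_snd))).mul
      ((continuous_snd.comp continuous_snd).pow _)

/-- reduction of the annihilating polynomial modulo `q` -/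
theorem exists_reduced {N : ℕ} (q : Ideal (MvPolynomial (Fin N) ℂ)) (hq : q ≠ ⊤)
    {P : MvPolynomial (Fin (N + 1)) ℂ} (hP : P ≠ 0) :
    ∃ Q : Polynomial (MvPolynomial (Fin N) ℂ), (∃ n, Q.coeff n ∉ q) ∧
      ∀ (U : Set (CE N)) (f : CE N → ℂ), IsOpen U → ContinuousOn f U →
        (∀ x ∈ U, eval (Fin.snoc (α := fun _ => ℂ) x (f x)) P = 0) →
        ∀ x ∈ U, (∀ p ∈ q, eval x p = 0) → Polynomial.eval₂ (eval x) (f x) Q = 0 := by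
  by_cases hV : ∃ x0 : CE N, ∀ p ∈ q, eval x0 p = 0
  swap
  · refine ⟨1, ⟨0, ?_⟩, fun U f _ _ _ x _ hx => (hV ⟨x, hx⟩).elim⟩
    simpa using (Ideal.ne_top_iff_one q).1 hq
  obtain ⟨x0, hx0⟩ := hV
  obtain ⟨w, hw⟩ := exists_eval_ne_zero hP
  obtain ⟨v, hv⟩ : ∃ v : CE N, v = Fin.init w - x0 := ⟨_, rfl⟩
  have hne : ∃ n, (spread v P).coeff n ∉ q.map Polynomial.C := by
    by_contra! hcon
    have h1 := pev2_eq_zero_of_coeff hx0 (w (Fin.last N)) 1 _ hcon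
    rw [pev2_spread] at h1
    apply hw
    rw [← h1]
    congr 1
    rw [hv, one_smul, add_sub_cancel]
    simp
  obtain ⟨r, p2, h1, h2⟩ := poly_split _ _ hne
  refine ⟨p2.coeff 0, ?_, ?_⟩
  · rw [Ideal.mem_map_C_iff] at h2
    simpa using h2
  intro U f hU hf hfP x hxU hxq
  have hcl : Tendsto (fun s : ℂ => x + s • v) (𝓝 0) (𝓝 x) := by
    have : Continuous fun s : ℂ => x + s • v := by fun_prop
    simpa using this.tendsto 0
  have hev : ∀ᶠ s in 𝓝[≠] (0:ℂ), pev2 x (f (x + s • v)) s p2 = 0 := by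
    have e1 : ∀ᶠ s in 𝓝[≠] (0:ℂ), x + s • v ∈ U :=
      (hcl.eventually (hU.eventually_mem hxU)).filter_mono nhdsWithin_le_nhds
    filter_upwards [e1, self_mem_nhdsWithin] with s hs1 hs0
    have e2 := pev2_eq_zero_of_coeff hxq (f (x + s • v)) s _ h1
    have e3 := hfP _ hs1
    rw [← pev2_spread] at e3
    unfold pev2 at e2 e3 ⊢
    rw [Polynomial.eval₂_sub, e3, Polynomial.eval₂_mul, Polynomial.eval₂_X_pow, zero_sub, neg_eq_zero] at e2
    exact (mul_eq_zero.1 e2).resolve_left (pow_ne_zero _ hs0)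
  have hlim : Tendsto (fun s : ℂ => pev2 x (f (x + s • v)) s p2) (𝓝 0) (𝓝 (pev2 x (f x) 0 p2)) := by
    have hfx : Tendsto f (𝓝 x) (𝓝 (f x)) := (hf.continuousAt (hU.mem_nhds hxU)).tendsto
    have := ((continuous_ev2 p2).tendsto (x, f x, 0)).comp
      (tendsto_const_nhds.prodMk_nhds ((hfx.comp hcl).prodMk_nhds tendsto_id))
    exact this
  have h0 : pev2 x (f x) 0 p2 = 0 := by
    refine tendsto_nhds_unique (hlim.mono_left (nhdsWithin_le_nhds (s := {0}ᶜ))) ?_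
    exact tendsto_const_nhds.congr' (hev.mono fun s hs => hs.symm)
  rw [pev2, Polynomial.eval₂_at_zero] at h0
  exact h0

theorem tendsto_ev {N : ℕ} (Q : Polynomial (MvPolynomial (Fin N) ℂ)) {f : CE N → ℂ} {x : CE N}
    (hpair : Tendsto (fun x' => ((x', f x') : CE N × ℂ)) (𝓝 x) (𝓝 (x, 0))) :
    Tendsto (fun x' => Polynomial.eval₂ (eval x') (f x') Q) (𝓝 x) (𝓝 (eval x (Q.coeff 0))) := by
  have h := ((continuous_ev Q).tendsto (x, 0)).comp hpair
  have hval : Polynomial.eval₂ (eval x) 0 Q = eval x (Q.coeff 0) := Polynomial.eval₂_at_zero _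
  rw [← hval]
  exact h

/-- Off a proper closed subset of `V(q)`, the zero set of `f` on `V(q)` is relatively open. -/
theorem nash_clopen {N : ℕ} (q : Ideal (MvPolynomial (Fin N) ℂ)) (hq : q ≠ ⊤)
    {P : MvPolynomial (Fin (N + 1)) ℂ} (hP : P ≠ 0) :
    ∃ h : MvPolynomial (Fin N) ℂ, h ∉ q ∧
      ∀ (U : Set (CE N)) (f : CE N → ℂ), IsOpen U → ContinuousOn f U →
        (∀ x ∈ U, eval (Fin.snoc (α := fun _ => ℂ) x (f x)) P = 0) →
        ∀ x ∈ U, eval x h ≠ 0 → f x = 0 →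
          ∀ᶠ x' in 𝓝 x, (∀ p ∈ q, eval x' p = 0) → f x' = 0 := by
  obtain ⟨Q, hQ, hQf⟩ := exists_reduced q hq hP
  obtain ⟨r, Q2, h1, h2⟩ := poly_split _ _ hQ
  refine ⟨Q2.coeff 0, h2, ?_⟩
  intro U f hU hf hfP x hxU hxh hfx
  have hfc : Tendsto f (𝓝 x) (𝓝 (f x)) := (hf.continuousAt (hU.mem_nhds hxU)).tendsto
  have hpair : Tendsto (fun x' => ((x', f x') : CE N × ℂ)) (𝓝 x) (𝓝 (x, 0)) := by
    have := (tendsto_id (x := 𝓝 x)).prodMk_nhds hfc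
    rw [hfx] at this
    exact this
  have hlim := tendsto_ev Q2 hpair
  filter_upwards [hlim.eventually_ne hxh, hU.eventually_mem hxU] with x' e1 e2 hx'
  have e3 := hQf U f hU hf hfP x' e2 hx'
  have e4 := pev_eq_zero_of_coeff hx' (f x') _ h1
  rw [Polynomial.eval₂_sub, e3, Polynomial.eval₂_mul, Polynomial.eval₂_X_pow, zero_sub, neg_eq_zero] at e4
  have e5 : f x' ^ r = 0 := (mul_eq_zero.1 e4).resolve_right e1
  by_contra hne
  exact pow_ne_zero r hne e5
end PartD1

section PartD2
/-- A building block of the stratification: a connected, relatively clopen piece of an étale stratum. -/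
def GoodPiece {N : ℕ} (G S : Set (CE N)) : Prop :=
  ∃ (q : Ideal (MvPolynomial (Fin N) ℂ)) (h : MvPolynomial (Fin N) ℂ) (D : EtPres q h),
    S ⊆ D.W ∩ G ∧ (∀ x ∈ S, ∀ᶠ x' in 𝓝 x, x' ∈ D.W → x' ∈ S) ∧
    (∀ x ∈ D.W ∩ G, x ∈ closure S → x ∈ S) ∧ IsPreconnected S ∧ S.Nonempty

/-- local Nash data with finitely many annihilating polynomials -/
def NashData {N : ℕ} (X : Set (CE N)) (Pset : Finset (MvPolynomial (Fin (N + 1)) ℂ)) : Prop :=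
  (∀ P ∈ Pset, P ≠ 0) ∧ ∀ x ∈ X, ∃ U : Set (CE N), IsOpen U ∧ x ∈ U ∧
    ∃ s : Finset (CE N → ℂ), (∀ f ∈ s, ContinuousOn f U ∧ f x = 0 ∧ ∃ P ∈ Pset, ∀ x' ∈ U,
      eval (Fin.snoc (α := fun _ => ℂ) x' (f x')) P = 0) ∧
      ∀ w ∈ U, (∀ f ∈ s, f w = 0) → w ∈ X

theorem exists_stratum {N : ℕ} {X : Set (CE N)} {Pset : Finset (MvPolynomial (Fin (N + 1)) ℂ)}
    (hX : NashData X Pset) (q : Ideal (MvPolynomial (Fin N) ℂ)) (hq : q.IsPrime) :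
    ∃ (h : MvPolynomial (Fin N) ℂ) (D : EtPres q h), ∀ x ∈ X, x ∈ D.W →
      ∀ᶠ x' in 𝓝 x, x' ∈ D.W → x' ∈ X := by
  classical
  have H : ∀ P : Pset, ∃ h : MvPolynomial (Fin N) ℂ, h ∉ q ∧
      ∀ (U : Set (CE N)) (f : CE N → ℂ), IsOpen U → ContinuousOn f U →
        (∀ x ∈ U, eval (Fin.snoc (α := fun _ => ℂ) x (f x)) P.1 = 0) →
        ∀ x ∈ U, eval x h ≠ 0 → f x = 0 →
          ∀ᶠ x' in 𝓝 x, (∀ p ∈ q, eval x' p = 0) → f x' = 0 :=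
    fun P => nash_clopen q hq.ne_top (hX.1 P.1 P.2)
  choose h hhq hh using H
  obtain ⟨D⟩ := exists_etPres q (∏ P, h P) (by
    intro hmem
    obtain ⟨P, _, hP⟩ := (Ideal.IsPrime.prod_mem_iff (p := q)).1 hmem
    exact hhq P hP)
  refine ⟨_, D, fun x hxX hxW => ?_⟩
  have hprod := D.hh x hxW.1 hxW.2
  rw [map_prod] at hprod
  have hne : ∀ P, eval x (h P) ≠ 0 := fun P => Finset.prod_ne_zero_iff.1 hprod P (Finset.mem_univ _)
  obtain ⟨U, hU, hxU, s, hs, hsX⟩ := hX.2 x hxX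
  have e1 : ∀ᶠ x' in 𝓝 x, ∀ f ∈ s, (∀ p ∈ q, eval x' p = 0) → f x' = 0 := by
    rw [Filter.eventually_all_finset]
    intro f hf
    obtain ⟨hfc, hfx, P, hP, hPf⟩ := hs f hf
    exact hh ⟨P, hP⟩ U f hU hfc hPf x hxU (hne _) hfx
  filter_upwards [e1, hU.eventually_mem hxU] with x' h1 h2 h3
  exact hsX x' h2 fun f hf => h1 f hf h3.1

theorem prime_pieces {m : ℕ} {Γ : Set (CE m)} (hΓo : IsOpen (cylOver 1 Γ)) (hΓ : IsSemialgebraic Γ)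
    {X : Set (CE (m + 1))} {Pset : Finset (MvPolynomial (Fin (m + 1 + 1)) ℂ)} (hX : NashData X Pset)
    (hXG : X ⊆ cylOver 1 Γ) (hXc : ∀ x ∈ cylOver 1 Γ, x ∈ closure X → x ∈ X)
    (q : Ideal (MvPolynomial (Fin (m + 1)) ℂ)) (hq : q.IsPrime) :
    ∃ (g : MvPolynomial (Fin (m + 1)) ℂ) (𝒮 : Set (Set (CE (m + 1)))), g ∉ q ∧ 𝒮.Finite ∧
      (∀ S ∈ 𝒮, GoodPiece (cylOver 1 Γ) S ∧ S ⊆ X) ∧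
      ∀ x ∈ X, (∀ p ∈ q, eval x p = 0) → eval x g ≠ 0 → ∃ S ∈ 𝒮, x ∈ S := by
  obtain ⟨h, D, hD⟩ := exists_stratum hX q hq
  have hWeq : D.W = {z : CE (m+1) | (∀ p ∈ q, eval z p = 0) ∧ eval z (bind₁ D.y D.δ) ≠ 0} := by
    ext z; simp only [D.eval_bind]; rfl
  have hfin := (semialg_cyl_finConn hΓ q (bind₁ D.y D.δ)).finite_components
  rw [← hWeq] at hfin
  refine ⟨bind₁ D.y D.δ, {C | ∃ x ∈ D.W ∩ cylOver 1 Γ, C = connectedComponentIn (D.W ∩ cylOver 1 Γ) x} ∩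
    {C | C ⊆ X}, D.hδ, hfin.subset inter_subset_left, ?_, ?_⟩
  · rintro S ⟨⟨a, ha, rfl⟩, hSX⟩
    refine ⟨⟨q, h, D, connectedComponentIn_subset _ _, fun x hx => D.component_open hΓo hx, ?_,
      isPreconnected_connectedComponentIn, ⟨a, mem_connectedComponentIn ha⟩⟩, hSX⟩
    intro x hx hxc
    have h1 : IsPreconnected (insert x (connectedComponentIn (D.W ∩ cylOver 1 Γ) a)) :=
      isPreconnected_connectedComponentIn.subset_closure (subset_insert _ _)
        (insert_subset hxc subset_closure)
    exact h1.subset_connectedComponentIn (mem_insert_of_mem _ (mem_connectedComponentIn ha))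
      (insert_subset hx (connectedComponentIn_subset _ _)) (mem_insert _ _)
  · intro x hxX hxq hxg
    have hxW : x ∈ D.W := by rw [hWeq]; exact ⟨hxq, hxg⟩
    have hxWG : x ∈ D.W ∩ cylOver 1 Γ := ⟨hxW, hXG hxX⟩
    refine ⟨_, ⟨⟨x, hxWG, rfl⟩, ?_⟩, mem_connectedComponentIn hxWG⟩
    intro z hz
    by_contra hzX
    have hsub := connectedComponentIn_subset (D.W ∩ cylOver 1 Γ) x
    have hzc : z ∈ (closure X)ᶜ := fun hc => hzX (hXc z (hsub hz).2 hc)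
    obtain ⟨w, hw, hw1, hw2⟩ := isPreconnected_connectedComponentIn (F := D.W ∩ cylOver 1 Γ) (x := x)
      (interior {x' | x' ∈ D.W → x' ∈ X}) (closure X)ᶜ isOpen_interior isClosed_closure.isOpen_compl
      (by
        intro w hw
        by_cases hwX : w ∈ X
        · exact Or.inl (mem_interior_iff_mem_nhds.2 (hD w hwX (hsub hw).1))
        · exact Or.inr fun hc => hwX (hXc w (hsub hw).2 hc))
      ⟨x, mem_connectedComponentIn hxWG, mem_interior_iff_mem_nhds.2 (hD x hxX hxW)⟩
      ⟨z, hz, hzc⟩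
    exact hw2 (subset_closure (interior_subset hw1 (hsub hw).1))

theorem pieces {m : ℕ} {Γ : Set (CE m)} (hΓo : IsOpen (cylOver 1 Γ)) (hΓ : IsSemialgebraic Γ)
    {X : Set (CE (m + 1))} {Pset : Finset (MvPolynomial (Fin (m + 1 + 1)) ℂ)} (hX : NashData X Pset)
    (hXG : X ⊆ cylOver 1 Γ) (hXc : ∀ x ∈ cylOver 1 Γ, x ∈ closure X → x ∈ X)
    (J : Ideal (MvPolynomial (Fin (m + 1)) ℂ)) :
    ∃ 𝒮 : Set (Set (CE (m + 1))), 𝒮.Finite ∧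
      (∀ S ∈ 𝒮, GoodPiece (cylOver 1 Γ) S ∧ S ⊆ X) ∧
      ∀ x ∈ X, (∀ p ∈ J, eval x p = 0) → ∃ S ∈ 𝒮, x ∈ S := by
  induction J using WellFoundedGT.induction with
  | ind J ih =>
  have key : ∀ a ∉ J, ∃ 𝒮 : Set (Set (CE (m + 1))), 𝒮.Finite ∧
      (∀ S ∈ 𝒮, GoodPiece (cylOver 1 Γ) S ∧ S ⊆ X) ∧
      ∀ x ∈ X, (∀ p ∈ J, eval x p = 0) → eval x a = 0 → ∃ S ∈ 𝒮, x ∈ S := by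
    intro a ha
    obtain ⟨𝒮, h1, h2, h3⟩ := ih (J ⊔ Ideal.span {a}) (by
      refine lt_of_le_of_ne le_sup_left fun e => ha ?_
      rw [e]
      exact Ideal.mem_sup_right (Ideal.mem_span_singleton_self a))
    refine ⟨𝒮, h1, h2, fun x hx hxJ hxa => h3 x hx ?_⟩
    have hle : J ⊔ Ideal.span {a} ≤ RingHom.ker (eval x) := by
      refine sup_le (fun p hp => hxJ p hp) ?_
      rw [Ideal.span_singleton_le_iff_mem]
      exact hxa
    exact fun p hp => hle hp
  by_cases htop : J = ⊤
  · refine ⟨∅, finite_empty, fun S hS => hS.elim, fun x _ hx => ?_⟩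
    have := hx 1 (by rw [htop]; trivial)
    simp at this
  by_cases hp : J.IsPrime
  · obtain ⟨g, 𝒮, hg, h1, h2, h3⟩ := prime_pieces hΓo hΓ hX hXG hXc J hp
    obtain ⟨𝒯, k1, k2, k3⟩ := key g hg
    refine ⟨𝒮 ∪ 𝒯, h1.union k1, fun S hS => hS.elim (h2 S) (k2 S), fun x hx hxJ => ?_⟩
    by_cases hxg : eval x g = 0
    · obtain ⟨S, hS, hxS⟩ := k3 x hx hxJ hxg
      exact ⟨S, Or.inr hS, hxS⟩
    · obtain ⟨S, hS, hxS⟩ := h3 x hx hxJ hxg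
      exact ⟨S, Or.inl hS, hxS⟩
  · have hab : ∃ a b, a * b ∈ J ∧ a ∉ J ∧ b ∉ J := by
      by_contra! hcon
      exact hp ⟨htop, fun {a b} hab => or_iff_not_imp_left.2 (hcon a b hab)⟩
    obtain ⟨a, b, hab, ha, hb⟩ := hab
    obtain ⟨𝒮, h1, h2, h3⟩ := key a ha
    obtain ⟨𝒯, k1, k2, k3⟩ := key b hb
    refine ⟨𝒮 ∪ 𝒯, h1.union k1, fun S hS => hS.elim (h2 S) (k2 S), fun x hx hxJ => ?_⟩
    have hz := hxJ _ hab
    rw [map_mul, mul_eq_zero] at hz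
    rcases hz with hz | hz
    · obtain ⟨S, hS, hxS⟩ := h3 x hx hxJ hz
      exact ⟨S, Or.inl hS, hxS⟩
    · obtain ⟨S, hS, hxS⟩ := k3 x hx hxJ hz
      exact ⟨S, Or.inr hS, hxS⟩
end PartD2

section PartI1
theorem IsAnalyticSet.inter' {N : ℕ} {G A B : Set (CE N)} (hA : IsAnalyticSet G A)
    (hB : IsAnalyticSet G B) : IsAnalyticSet G (A ∩ B) := by
  classical
  refine ⟨inter_subset_left.trans hA.1, fun z hz => ?_⟩
  obtain ⟨U, hU, hzU, hUG, s, hs, hsA⟩ := hA.2 z hz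
  obtain ⟨V, hV, hzV, hVG, t, ht, htB⟩ := hB.2 z hz
  refine ⟨U ∩ V, hU.inter hV, ⟨hzU, hzV⟩, inter_subset_left.trans hUG, s ∪ t, ?_, ?_⟩
  · intro f hf
    rcases Finset.mem_union.1 hf with hf | hf
    · exact (hs f hf).mono inter_subset_left
    · exact (ht f hf).mono inter_subset_right
  · ext w
    have h1 : w ∈ A ∩ U ↔ w ∈ U ∧ ∀ f ∈ s, f w = 0 := by rw [hsA]; rfl
    have h2 : w ∈ B ∩ V ↔ w ∈ V ∧ ∀ f ∈ t, f w = 0 := by rw [htB]; rfl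
    constructor
    · rintro ⟨⟨ha, hb⟩, hu, hv⟩
      refine ⟨⟨hu, hv⟩, fun f hf => ?_⟩
      rcases Finset.mem_union.1 hf with hf | hf
      · exact (h1.1 ⟨ha, hu⟩).2 f hf
      · exact (h2.1 ⟨hb, hv⟩).2 f hf
    · rintro ⟨⟨hu, hv⟩, hf⟩
      exact ⟨⟨(h1.2 ⟨hu, fun f h => hf f (Finset.mem_union_left _ h)⟩).1,
        (h2.2 ⟨hv, fun f h => hf f (Finset.mem_union_right _ h)⟩).1⟩, hu, hv⟩

theorem IsAnalyticSet.union' {N : ℕ} {G A B : Set (CE N)} (hA : IsAnalyticSet G A)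
    (hB : IsAnalyticSet G B) : IsAnalyticSet G (A ∪ B) := by
  classical
  refine ⟨union_subset hA.1 hB.1, fun z hz => ?_⟩
  obtain ⟨U, hU, hzU, hUG, s, hs, hsA⟩ := hA.2 z hz
  obtain ⟨V, hV, hzV, hVG, t, ht, htB⟩ := hB.2 z hz
  refine ⟨U ∩ V, hU.inter hV, ⟨hzU, hzV⟩, inter_subset_left.trans hUG,
    (s ×ˢ t).image (fun p => p.1 * p.2), ?_, ?_⟩
  · intro f hf
    obtain ⟨⟨a, b⟩, hab, rfl⟩ := Finset.mem_image.1 hf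
    obtain ⟨ha, hb⟩ := Finset.mem_product.1 hab
    exact ((hs a ha).mono inter_subset_left).mul ((ht b hb).mono inter_subset_right)
  · ext w
    have h1 : w ∈ A ∩ U ↔ w ∈ U ∧ ∀ f ∈ s, f w = 0 := by rw [hsA]; rfl
    have h2 : w ∈ B ∩ V ↔ w ∈ V ∧ ∀ f ∈ t, f w = 0 := by rw [htB]; rfl
    constructor
    · rintro ⟨hab, hu, hv⟩
      refine ⟨⟨hu, hv⟩, fun f hf => ?_⟩
      obtain ⟨⟨a, b⟩, hab', rfl⟩ := Finset.mem_image.1 hf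
      obtain ⟨ha, hb⟩ := Finset.mem_product.1 hab'
      show a w * b w = 0
      rcases hab with h | h
      · rw [(h1.1 ⟨h, hu⟩).2 a ha, zero_mul]
      · rw [(h2.1 ⟨h, hv⟩).2 b hb, mul_zero]
    · rintro ⟨⟨hu, hv⟩, hf⟩
      refine ⟨?_, hu, hv⟩
      by_contra hcon
      rw [Set.mem_union, not_or] at hcon
      have k1 : ∃ a ∈ s, a w ≠ 0 := by
        by_contra! hc
        exact hcon.1 (h1.2 ⟨hu, hc⟩).1
      have k2 : ∃ b ∈ t, b w ≠ 0 := by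
        by_contra! hc
        exact hcon.2 (h2.2 ⟨hv, hc⟩).1
      obtain ⟨a, ha, ha0⟩ := k1
      obtain ⟨b, hb, hb0⟩ := k2
      have := hf _ (Finset.mem_image.2 ⟨(a, b), Finset.mem_product.2 ⟨ha, hb⟩, rfl⟩)
      exact mul_ne_zero ha0 hb0 this

theorem isAnalyticSet_empty' {N : ℕ} {G : Set (CE N)} (hG : IsOpen G) : IsAnalyticSet G ∅ := by
  refine ⟨empty_subset _, fun z hz => ⟨G, hG, hz, Subset.rfl, {fun _ => 1}, ?_, ?_⟩⟩
  · intro f hf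
    rw [Finset.mem_singleton] at hf
    rw [hf]
    exact fun _ _ => analyticAt_const
  · ext w; simp

theorem irred_subset_of_finite {N : ℕ} {G : Set (CE N)} (hG : IsOpen G) {C : Set (CE N)}
    (hC : IsIrreducibleAnalyticSet G C) {T : Set (Set (CE N))} (hT : T.Finite) :
    (∀ D ∈ T, IsAnalyticSet G D) → IsAnalyticSet G (⋃₀ T) ∧ (C ⊆ ⋃₀ T → ∃ D ∈ T, C ⊆ D) := by
  induction T, hT using Set.Finite.induction_on with
  | empty =>
    intro _
    rw [sUnion_empty]
    refine ⟨isAnalyticSet_empty' hG, fun h => ?_⟩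
    obtain ⟨x, hx⟩ := hC.2.1
    exact (h hx).elim
  | @insert D T _ _ ih =>
    intro hall
    obtain ⟨i1, i2⟩ := ih fun D' h' => hall D' (mem_insert_of_mem _ h')
    have hD := hall D (mem_insert _ _)
    rw [sUnion_insert]
    refine ⟨hD.union' i1, fun h => ?_⟩
    rcases hC.2.2 (C ∩ D) (C ∩ ⋃₀ T) (hC.1.inter' hD) (hC.1.inter' i1) (by
      rw [← inter_union_distrib_left, inter_eq_left.2 h]) with e | e
    · exact ⟨D, mem_insert _ _, inter_eq_left.1 e.symm⟩
    · obtain ⟨D', h1, h2⟩ := i2 (inter_eq_left.1 e.symm)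
      exact ⟨D', mem_insert_of_mem _ h1, h2⟩

theorem GoodPiece.irreducible {N : ℕ} {G S : Set (CE N)} (hG : IsOpen G) (hS : GoodPiece G S) :
    IsIrreducibleAnalyticSet G (closure S ∩ G) := by
  obtain ⟨q, h, D, hSW, hSo, hSc, hSp, x, hx⟩ := hS
  refine ⟨D.closure_analytic hG hSW hSo hSc, ⟨x, subset_closure hx, (hSW hx).2⟩, ?_⟩
  intro A B hA hB hAB
  have hsub : S ⊆ A ∪ B := by
    rw [← hAB]
    exact fun z hz => ⟨subset_closure hz, (hSW hz).2⟩
  have key : ∀ A : Set (CE N), IsAnalyticSet G A → S ⊆ A → closure S ∩ G ⊆ A :=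
    fun A hA hSA z hz => hA.mem_of_mem_closure hz.2 (closure_mono hSA hz.1)
  rcases D.irred_aux hG hSW hSo hSp hA hB hsub with h1 | h1
  · exact Or.inl (Subset.antisymm (key A hA h1) (hAB ▸ subset_union_left))
  · exact Or.inr (Subset.antisymm (key B hB h1) (hAB ▸ subset_union_right))

theorem continuous_projFst (a b : ℕ) : Continuous (projFst a b) :=
  continuous_pi fun i => continuous_apply (Fin.castAdd b i)

theorem exists_nashData {m : ℕ} {Ω : Set (CE m)} {Y : Set (CE (m + 1))}
    (hNash : IsNashSet (cylOver 1 Ω) Y) (hproper : ProperProjTo Y Ω)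
    {Γ : Set (CE m)} (hΓo : IsOpen (cylOver 1 Γ))
    (hΓc : IsCompact (closure Γ)) (hΓΩ : closure Γ ⊆ Ω) :
    ∃ Pset, NashData (Y ∩ cylOver 1 Γ) Pset := by
  classical
  have hK := hproper.2 _ hΓc hΓΩ
  have hloc : ∀ y : CE (m + 1), y ∈ {z ∈ Y | projFst m 1 z ∈ closure Γ} →
      ∃ (O : Set (CE (m+1))) (s : Finset (CE (m+1) → ℂ)) (Q : Finset (MvPolynomial (Fin (m+1+1)) ℂ)),
      IsOpen O ∧ y ∈ O ∧ (∀ P ∈ Q, P ≠ 0) ∧ (∀ f ∈ s, ContinuousOn f O ∧ ∃ P ∈ Q, ∀ x' ∈ O,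
      eval (Fin.snoc (α := fun _ => ℂ) x' (f x')) P = 0) ∧ Y ∩ O = {x ∈ O | ∀ f ∈ s, f x = 0} := by
    intro y hy
    obtain ⟨U, hU, hyU, hUG, s, hs, hsY⟩ := hNash.2 y (hNash.1 hy.1)
    choose! V hV using fun f (hf : f ∈ s) => (hs f hf).2 y hyU
    choose! P hP using fun f (hf : f ∈ s) => (hV f hf).2.2.2
    refine ⟨U ∩ ⋂ f ∈ s, V f, s, s.image P, hU.inter (isOpen_biInter_finset fun f hf => (hV f hf).1),
      ⟨hyU, mem_iInter₂.2 fun f hf => (hV f hf).2.1⟩, ?_, ?_, ?_⟩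
    · intro p hp
      obtain ⟨f, hf, rfl⟩ := Finset.mem_image.1 hp
      exact (hP f hf).1
    · intro f hf
      refine ⟨(hs f hf).1.continuousOn.mono inter_subset_left, P f, Finset.mem_image_of_mem _ hf, ?_⟩
      intro x' hx'
      exact (hP f hf).2 x' (mem_iInter₂.1 hx'.2 f hf)
    · rw [← inter_assoc, hsY]
      ext w
      constructor
      · rintro ⟨⟨h1, h2⟩, h3⟩; exact ⟨⟨h1, h3⟩, h2⟩
      · rintro ⟨⟨h1, h3⟩, h2⟩; exact ⟨⟨h1, h2⟩, h3⟩
  choose! O s Q hO hyO hQ hs hY using hloc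
  obtain ⟨t, htK, ht⟩ := hK.elim_nhds_subcover O fun y hy => (hO y hy).mem_nhds (hyO y hy)
  refine ⟨t.biUnion Q, ?_, ?_⟩
  · intro P hP
    obtain ⟨y, hy, hPy⟩ := Finset.mem_biUnion.1 hP
    exact hQ y (htK y hy) P hPy
  · intro x hx
    obtain ⟨y, hyt, hxy⟩ := mem_iUnion₂.1 (ht ⟨hx.1, subset_closure hx.2⟩)
    have hyK := htK y hyt
    refine ⟨O y ∩ cylOver 1 Γ, (hO y hyK).inter hΓo, ⟨hxy, hx.2⟩, s y, ?_, ?_⟩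
    · intro f hf
      obtain ⟨h1, P, hP, h2⟩ := hs y hyK f hf
      have hxz : x ∈ Y ∩ O y := ⟨hx.1, hxy⟩
      rw [hY y hyK] at hxz
      exact ⟨h1.mono inter_subset_left, hxz.2 f hf, P, Finset.mem_biUnion.2 ⟨y, hyt, hP⟩,
        fun x' hx' => h2 x' hx'.1⟩
    · intro w hw hf
      have : w ∈ Y ∩ O y := by rw [hY y hyK]; exact ⟨hw.1, hf⟩
      exact ⟨this.1, hw.2⟩
end PartI1

/-- Let `Ω ⊆ ℂ^m` be open, `Y` a Nash subset of `Ω × ℂ` of pure dimension `k`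
with proper projection onto `Ω`, and `Γ ⊂⊂ Ω` a bounded open semialgebraic subset of `ℂ^m`.
Then `Y ∩ (Γ × ℂ)` has only finitely many analytic irreducible components. -/
theorem finitely_many_components (m k : ℕ) (Ω : Set (CE m)) (hΩ : IsOpen Ω)
    (Y : Set (CE (m + 1))) (hNash : IsNashSet (cylOver 1 Ω) Y)
    (hdim : PureDimOf Y k) (hproper : ProperProjTo Y Ω)
    (Γ : Set (CE m)) (hΓo : IsOpen Γ) (hΓb : Bornology.IsBounded Γ)
    (hΓc : IsCompact (closure Γ)) (hΓΩ : closure Γ ⊆ Ω)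
    (hΓsa : IsSemialgebraic Γ) :
    {C | IsIrreducibleComponent (cylOver 1 Γ) (Y ∩ cylOver 1 Γ) C}.Finite := by
  have hG : IsOpen (cylOver 1 Γ) := hΓo.preimage (continuous_projFst m 1)
  obtain ⟨Pset, hX⟩ := exists_nashData hNash hproper hG hΓc hΓΩ
  have hXc : ∀ x ∈ cylOver 1 Γ, x ∈ closure (Y ∩ cylOver 1 Γ) → x ∈ Y ∩ cylOver 1 Γ := by
    intro x hx hxc
    have hK := hproper.2 _ hΓc hΓΩ
    have hsub : closure (Y ∩ cylOver 1 Γ) ⊆ {z ∈ Y | projFst m 1 z ∈ closure Γ} :=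
      closure_minimal (fun z hz => ⟨hz.1, subset_closure hz.2⟩) hK.isClosed
    exact ⟨(hsub hxc).1, hx⟩
  obtain ⟨T, hT, hTgood, hTcov⟩ := pieces hG hΓsa hX inter_subset_right hXc ⊥
  refine (hT.image fun S => closure S ∩ cylOver 1 Γ).subset ?_
  intro C hC
  have hirr : ∀ D ∈ (fun S => closure S ∩ cylOver 1 Γ) '' T,
      IsIrreducibleAnalyticSet (cylOver 1 Γ) D ∧ D ⊆ Y ∩ cylOver 1 Γ := by
    rintro _ ⟨S, hS, rfl⟩
    exact ⟨(hTgood S hS).1.irreducible hG,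
      fun z hz => hXc z hz.2 (closure_mono (hTgood S hS).2 hz.1)⟩
  obtain ⟨_, hsub⟩ := irred_subset_of_finite hG hC.1
    (hT.image fun S => closure S ∩ cylOver 1 Γ) fun D hD => (hirr D hD).1.1
  obtain ⟨D, hD, hCD⟩ := hsub (by
    intro z hz
    have hzX := hC.2.1 hz
    obtain ⟨S, hS, hzS⟩ := hTcov z hzX (by
      intro p hp
      rw [Ideal.mem_bot] at hp
      rw [hp, map_zero])
    exact ⟨_, ⟨S, hS, rfl⟩, subset_closure hzS, hzX.2⟩)
  have := hC.2.2 D (hirr D hD).1 hCD (hirr D hD).2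
  exact this ▸ hD
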